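/- arXiv:1107.3177 — 10 statements merged into one kernel-verified Lean document; each statement's English description precedes it below -/
import Mathlib

section
/- For any (d_v,d_c)-regular Tanner graph, any LLR vector γ ∈ ℝ^{V_L} and any β ≥ 0, the AMP operator A satisfies ‖A[μ] − A[ν]‖_∞ ≤ β(d_v−1)(d_c−1)·‖μ − ν‖_∞ for all AMP message vectors μ, ν ∈ ℝ^{2|E|}. In particular, if β(d_v−1)(d_c−1) < 1 then A is a contraction on ℝ^{2|E|} with respect to ‖·‖_∞ and has a unique fixed point μ*, to which the iterates μ^{(ℓ+1)} = A[μ^{(ℓ)}] converge from any initialization. -/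
open Finset Filter

/-- The real value of a bit. -/
def bv (b : Bool) : ℝ := if b then 1 else 0

/-- `Skin Nc k i x` : the set of local assignments `w` with `w i = x` and even parity
on the neighborhood of check node `k` (the set `S_{k,i}(x)`). -/
def Skin {VL VR : Type*} [Fintype VL] [DecidableEq VL]
    (Nc : VR → Finset VL) (k : VR) (i : VL) (x : Bool) : Finset (VL → Bool) :=
  Finset.univ.filter (fun w => w i = x ∧ Even (((Nc k).filter (fun m => w m = true)).card))

/-- The AMP operator `A`:
`(A[μ])_{i→j}(x) = (1−x)·γ_i + β·Σ_{k∈N(i)\{j}} max_{w∈S_{k,i}(x)} Σ_{m∈N(k)\{i}} μ_{m→k}(w_m)`. -/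
noncomputable def Aop {VL VR : Type*} [Fintype VL] [DecidableEq VL] [DecidableEq VR]
    (Nv : VL → Finset VR) (Nc : VR → Finset VL) (γ : VL → ℝ) (β : ℝ)
    (μ : VL → VR → Bool → ℝ) : VL → VR → Bool → ℝ :=
  fun i j x => (1 - bv x) * γ i +
    β * ∑ k ∈ (Nv i).erase j,
      ⨆ w : {w : VL → Bool // w ∈ Skin Nc k i x}, ∑ m ∈ (Nc k).erase i, μ m k (w.1 m)

/-- Sup-norm over edges (and bits) of an AMP message vector. -/
noncomputable def ampSup {VL VR : Type*} (Nv : VL → Finset VR)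
    (μ : VL → VR → Bool → ℝ) : ℝ :=
  ⨆ p : {q : (VL × VR) × Bool // q.1.2 ∈ Nv q.1.1}, |μ p.1.1.1 p.1.1.2 p.1.2|

/-- The finset of edges of the Tanner graph. -/
def Edges {VL VR : Type*} [Fintype VL] [Fintype VR] [DecidableEq VR]
    (Nv : VL → Finset VR) : Finset (VL × VR) :=
  Finset.univ.filter (fun p => p.2 ∈ Nv p.1)

/-- AMP-consistency of an edge-indexed family of bits: for each variable node all incident
edges carry the same bit, and the resulting vector of common bits is a codeword. -/
def AMPConsistent {VL VR : Type*} (Nv : VL → Finset VR) (Nc : VR → Finset VL)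
    (xs : VL → VR → Bool) : Prop :=
  (∀ i : VL, ∀ j ∈ Nv i, ∀ j' ∈ Nv i, xs i j = xs i j') ∧
  (∀ k : VR, Even (((Nc k).filter (fun i => ∀ j ∈ Nv i, xs i j = true)).card))

theorem abs_ciSup_sub_ciSup_le {ι : Type*} [Finite ι] {f g : ι → ℝ} {C : ℝ} (hC : 0 ≤ C)
    (h : ∀ a, |f a - g a| ≤ C) : |(⨆ a, f a) - ⨆ a, g a| ≤ C := by
  cases isEmpty_or_nonempty ι
  · simpa [Real.iSup_of_isEmpty] using hC
  have ciSup_le_add : ∀ u v : ι → ℝ, (∀ a, |u a - v a| ≤ C) → (⨆ a, u a) ≤ (⨆ a, v a) + C := by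
    intro u v huv
    refine ciSup_le fun a => ?_
    have := le_ciSup (Set.finite_range v).bddAbove a
    linarith [(abs_le.1 (huv a)).2]
  have hfg := ciSup_le_add f g h
  have hgf := ciSup_le_add g f fun a => by rw [abs_sub_comm]; exact h a
  rw [abs_le]
  constructor <;> linarith

theorem abs_le_ampSup {VL VR : Type*} [Finite VL] [Finite VR] (Nv : VL → Finset VR)
    (μ : VL → VR → Bool → ℝ) {i : VL} {j : VR} (hj : j ∈ Nv i) (x : Bool) :
    |μ i j x| ≤ ampSup Nv μ :=
  le_ciSup (f := fun p : {q : (VL × VR) × Bool // q.1.2 ∈ Nv q.1.1} =>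
    |μ p.1.1.1 p.1.1.2 p.1.2|) (Set.finite_range _).bddAbove ⟨((i, j), x), hj⟩

theorem ampSup_nonneg {VL VR : Type*} (Nv : VL → Finset VR) (μ : VL → VR → Bool → ℝ) :
    0 ≤ ampSup Nv μ :=
  Real.iSup_nonneg fun _ => abs_nonneg _

/-- A bound on the difference of two message vectors along the edges is scaled by at most
`β(d_v−1)(d_c−1)` under the AMP operator. -/
theorem abs_Aop_sub_Aop_le {VL VR : Type*} [Fintype VL] [DecidableEq VL] [DecidableEq VR]
    {Nv : VL → Finset VR} {Nc : VR → Finset VL} {dv dc : ℕ}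
    (hsym : ∀ (i : VL) (j : VR), j ∈ Nv i ↔ i ∈ Nc j)
    (hdv : ∀ i : VL, (Nv i).card = dv) (hdc : ∀ j : VR, (Nc j).card = dc)
    (γ : VL → ℝ) {β : ℝ} (hβ : 0 ≤ β) {μ ν : VL → VR → Bool → ℝ} {D : ℝ} (hD : 0 ≤ D)
    (h : ∀ i, ∀ j ∈ Nv i, ∀ x, |μ i j x - ν i j x| ≤ D)
    (i : VL) {j : VR} (hj : j ∈ Nv i) (x : Bool) :
    |Aop Nv Nc γ β μ i j x - Aop Nv Nc γ β ν i j x|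
      ≤ β * ((dv : ℝ) - 1) * ((dc : ℝ) - 1) * D := by
  have card_check : ∀ k ∈ Nv i, (((Nc k).erase i).card : ℝ) = (dc : ℝ) - 1 := by
    intro k hk
    rw [cast_card_erase_of_mem ((hsym i k).1 hk), hdc]
  have card_var : (((Nv i).erase j).card : ℝ) = (dv : ℝ) - 1 := by
    rw [cast_card_erase_of_mem hj, hdv]
  have check_le : ∀ k ∈ (Nv i).erase j,
      |(⨆ w : {w : VL → Bool // w ∈ Skin Nc k i x}, ∑ m ∈ (Nc k).erase i, μ m k (w.1 m)) -
        ⨆ w : {w : VL → Bool // w ∈ Skin Nc k i x}, ∑ m ∈ (Nc k).erase i, ν m k (w.1 m)|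
        ≤ ((dc : ℝ) - 1) * D := by
    intro k hk
    rw [← card_check k (mem_of_mem_erase hk)]
    refine abs_ciSup_sub_ciSup_le (by positivity) fun w => ?_
    rw [← sum_sub_distrib, ← nsmul_eq_mul]
    exact (abs_sum_le_sum_abs _ _).trans <| sum_le_card_nsmul _ _ _ fun m hm =>
      h m k ((hsym m k).2 (mem_of_mem_erase hm)) _
  simp only [Aop, add_sub_add_left_eq_sub]
  rw [← mul_sub, ← sum_sub_distrib, abs_mul, abs_of_nonneg hβ, mul_assoc, mul_assoc]
  refine mul_le_mul_of_nonneg_left ?_ hβ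
  rw [← card_var, ← nsmul_eq_mul]
  exact (abs_sum_le_sum_abs _ _).trans (sum_le_card_nsmul _ _ _ check_le)

/-- The coordinates of an AMP message vector that belong to edges. -/
def edgeRestrict {VL VR : Type*} (Nv : VL → Finset VR) (μ : VL → VR → Bool → ℝ) :
    {q : (VL × VR) × Bool // q.1.2 ∈ Nv q.1.1} → ℝ :=
  fun p => μ p.1.1.1 p.1.1.2 p.1.2

/-- Extension by zero of an edge-indexed message vector. -/
def edgeExtend {VL VR : Type*} [DecidableEq VR] (Nv : VL → Finset VR)
    (f : {q : (VL × VR) × Bool // q.1.2 ∈ Nv q.1.1} → ℝ) : VL → VR → Bool → ℝ :=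
  fun i j x => if h : j ∈ Nv i then f ⟨((i, j), x), h⟩ else 0

theorem edgeExtend_apply {VL VR : Type*} [DecidableEq VR] {Nv : VL → Finset VR}
    (f : {q : (VL × VR) × Bool // q.1.2 ∈ Nv q.1.1} → ℝ) {i : VL} {j : VR}
    (hj : j ∈ Nv i) (x : Bool) : edgeExtend Nv f i j x = f ⟨((i, j), x), hj⟩ :=
  dif_pos hj

/-- The AMP operator is Lipschitz with constant `β(d_v−1)(d_c−1)` in the
sup norm over edges; in particular, when `β(d_v−1)(d_c−1) < 1` it is a contraction and has a
unique fixed point (on edges), to which the iterates converge from any initialization. -/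
theorem amp_operator_contraction
    {VL VR : Type*} [Fintype VL] [Fintype VR] [DecidableEq VL] [DecidableEq VR]
    [Nonempty VL] [Nonempty VR]
    (Nv : VL → Finset VR) (Nc : VR → Finset VL) (dv dc : ℕ)
    (hsym : ∀ (i : VL) (j : VR), j ∈ Nv i ↔ i ∈ Nc j)
    (hdv : ∀ i : VL, (Nv i).card = dv) (hdc : ∀ j : VR, (Nc j).card = dc)
    (hdv2 : 2 ≤ dv) (hdc2 : 2 ≤ dc)
    (γ : VL → ℝ) (β : ℝ) (hβ : 0 ≤ β) :
    (∀ μ ν : VL → VR → Bool → ℝ,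
      ampSup Nv (fun i j x => Aop Nv Nc γ β μ i j x - Aop Nv Nc γ β ν i j x)
        ≤ β * ((dv : ℝ) - 1) * ((dc : ℝ) - 1) * ampSup Nv (fun i j x => μ i j x - ν i j x)) ∧
    (β * ((dv : ℝ) - 1) * ((dc : ℝ) - 1) < 1 →
      ∃ μs : VL → VR → Bool → ℝ,
        (∀ i : VL, ∀ j ∈ Nv i, ∀ x : Bool, μs i j x = Aop Nv Nc γ β μs i j x) ∧
        (∀ ν : VL → VR → Bool → ℝ,
          (∀ i : VL, ∀ j ∈ Nv i, ∀ x : Bool, ν i j x = Aop Nv Nc γ β ν i j x) →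
          ∀ i : VL, ∀ j ∈ Nv i, ∀ x : Bool, ν i j x = μs i j x) ∧
        (∀ μ0 : VL → VR → Bool → ℝ, ∀ i : VL, ∀ j ∈ Nv i, ∀ x : Bool,
          Tendsto (fun n => (Aop Nv Nc γ β)^[n] μ0 i j x) atTop (nhds (μs i j x)))) := by
  have bound : ∀ {μ ν : VL → VR → Bool → ℝ} {D : ℝ}, 0 ≤ D →
      (∀ i, ∀ j ∈ Nv i, ∀ x, |μ i j x - ν i j x| ≤ D) → ∀ i, ∀ j ∈ Nv i, ∀ x,
      |Aop Nv Nc γ β μ i j x - Aop Nv Nc γ β ν i j x|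
        ≤ β * ((dv : ℝ) - 1) * ((dc : ℝ) - 1) * D :=
    fun hD h i _ hj x => abs_Aop_sub_Aop_le hsym hdv hdc γ hβ hD h i hj x
  have hdv1 : (0 : ℝ) ≤ (dv : ℝ) - 1 := sub_nonneg.2 (by exact_mod_cast one_le_two.trans hdv2)
  have hdc1 : (0 : ℝ) ≤ (dc : ℝ) - 1 := sub_nonneg.2 (by exact_mod_cast one_le_two.trans hdc2)
  have hK : 0 ≤ β * ((dv : ℝ) - 1) * ((dc : ℝ) - 1) := by positivity
  refine ⟨fun μ ν => ?_, fun hlt => ?_⟩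
  · refine Real.iSup_le (fun p => ?_) (mul_nonneg hK (ampSup_nonneg _ _))
    exact bound (ampSup_nonneg _ _)
      (fun i j hj x => abs_le_ampSup Nv (fun i j x => μ i j x - ν i j x) hj x) _ _ p.2 _
  set T := fun f => edgeRestrict Nv (Aop Nv Nc γ β (edgeExtend Nv f))
  have contracting : ContractingWith ⟨_, hK⟩ T := by
    refine ⟨hlt, LipschitzWith.of_dist_le_mul fun f g => ?_⟩
    refine (dist_pi_le_iff (mul_nonneg hK dist_nonneg)).2 fun p => ?_
    refine bound dist_nonneg (fun i j hj x => ?_) _ _ p.2 _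
    rw [edgeExtend_apply f hj, edgeExtend_apply g hj]
    exact dist_le_pi_dist f g _
  have semiconj : Function.Semiconj (edgeRestrict Nv) (Aop Nv Nc γ β) T := by
    intro μ
    funext p
    have h := bound (μ := μ) (ν := edgeExtend Nv (edgeRestrict Nv μ)) le_rfl
      (fun i j hj x => by simp [edgeExtend_apply _ hj, edgeRestrict]) _ _ p.2 p.1.2
    rw [mul_zero] at h
    exact sub_eq_zero.1 (abs_nonpos_iff.1 h)
  have fixed := contracting.fixedPoint_isFixedPt
  refine ⟨edgeExtend Nv (contracting.fixedPoint T), fun i j hj x => ?_,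
    fun ν hν i j hj x => ?_, fun μ0 i j hj x => ?_⟩
  · rw [edgeExtend_apply _ hj]
    exact (congrFun fixed ⟨((i, j), x), hj⟩).symm
  · have hfix : Function.IsFixedPt T (edgeRestrict Nv ν) :=
      (semiconj ν).symm.trans (funext fun p => (hν _ _ p.2 _).symm)
    rw [edgeExtend_apply _ hj, ← contracting.fixedPoint_unique hfix]
    rfl
  · rw [edgeExtend_apply _ hj]
    have h := tendsto_pi_nhds.1
      (contracting.tendsto_iterate_fixedPoint (edgeRestrict Nv μ0)) ⟨((i, j), x), hj⟩
    refine h.congr fun n => ?_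
    rw [← (semiconj.iterate_right n) μ0]
    rfl
end

section
/- Suppose 0 ≤ β(d_v−1)(d_c−1) < 1, let μ* be the fixed point of the AMP operator A, and suppose that for each edge (i,j) ∈ E the bit x*_{i,j} ∈ {0,1} uniquely maximizes x ↦ μ*_{i→j}(x). Then for every binary assignment {x_{i,j}} ∈ {0,1}^{E}: Σ_{(i,j)∈E} μ*_{i→j}(x_{i,j}) ≤ Σ_{(i,j)∈E} (1−x_{i,j})γ_i + β(d_v−1)(d_c−1)·Σ_{(i,j)∈E} μ*_{i→j}(x*_{i,j}). Moreover, if the assignment {x*_{i,j}} is AMP-consistent, then equality holds when x_{i,j} = x*_{i,j} for all (i,j) ∈ E. -/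
open Finset Filter

/-- Summing over `i ∈ s` the sums of `f` over `s \ {i}` counts every value `#s - 1` times. -/
lemma sum_sum_erase {ι : Type*} [DecidableEq ι] (s : Finset ι) (f : ι → ℝ) :
    ∑ i ∈ s, ∑ m ∈ s.erase i, f m = ((s.card : ℝ) - 1) * ∑ m ∈ s, f m := by
  have h : ∀ i ∈ s, ∑ m ∈ s.erase i, f m = ∑ m ∈ s, f m - f i := fun i hi => by
    rw [← Finset.add_sum_erase s f hi]; ring
  rw [Finset.sum_congr rfl h, Finset.sum_sub_distrib, Finset.sum_const, nsmul_eq_mul]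
  ring

lemma sum_Edges {VL VR : Type*} [Fintype VL] [Fintype VR] [DecidableEq VR]
    (Nv : VL → Finset VR) (f : VL → VR → ℝ) :
    ∑ p ∈ Edges Nv, f p.1 p.2 = ∑ i, ∑ j ∈ Nv i, f i j :=
  Finset.sum_finset_product' _ _ _ (by simp [Edges])

/-- Double counting of the extrinsic sums around the check nodes of a regular Tanner graph. -/
lemma sum_extrinsic {VL VR : Type*} [Fintype VL] [Fintype VR] [DecidableEq VL] [DecidableEq VR]
    (Nv : VL → Finset VR) (Nc : VR → Finset VL) (dv dc : ℕ)
    (hsym : ∀ (i : VL) (j : VR), j ∈ Nv i ↔ i ∈ Nc j)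
    (hdv : ∀ i : VL, (Nv i).card = dv) (hdc : ∀ j : VR, (Nc j).card = dc)
    (f : VL → VR → ℝ) :
    ∑ p ∈ Edges Nv, ∑ k ∈ (Nv p.1).erase p.2, ∑ m ∈ (Nc k).erase p.1, f m k =
      ((dv : ℝ) - 1) * ((dc : ℝ) - 1) * ∑ p ∈ Edges Nv, f p.1 p.2 := by
  have hcomm : ∀ g : VL → VR → ℝ, ∑ i, ∑ j ∈ Nv i, g i j = ∑ j, ∑ i ∈ Nc j, g i j :=
    fun g => Finset.sum_comm' (by simp [hsym])
  rw [sum_Edges Nv fun i j => ∑ k ∈ (Nv i).erase j, ∑ m ∈ (Nc k).erase i, f m k,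
    sum_Edges Nv f]
  simp_rw [fun i => sum_sum_erase (Nv i) fun k => ∑ m ∈ (Nc k).erase i, f m k, hdv,
    ← Finset.mul_sum]
  rw [hcomm fun i k => ∑ m ∈ (Nc k).erase i, f m k, hcomm f]
  simp_rw [fun k => sum_sum_erase (Nc k) fun m => f m k, hdc, ← Finset.mul_sum]
  ring

lemma Skin_nonempty {VL VR : Type*} [Fintype VL] [DecidableEq VL]
    (Nc : VR → Finset VL) (k : VR) (i : VL) (x : Bool) (hi : i ∈ Nc k)
    (hc : 2 ≤ (Nc k).card) : (Skin Nc k i x).Nonempty := by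
  obtain ⟨m, hm, hmi⟩ := Finset.exists_mem_ne (by omega : 1 < (Nc k).card) i
  refine ⟨fun l => x && (decide (l = i) || decide (l = m)), ?_⟩
  rw [Skin, Finset.mem_filter]
  refine ⟨Finset.mem_univ _, by simp, ?_⟩
  cases x
  · simp
  · have h : (Nc k).filter (fun l => (true && (decide (l = i) || decide (l = m))) = true) =
        {i, m} := by
      ext l
      simp only [Finset.mem_filter, Bool.true_and, Bool.or_eq_true, decide_eq_true_eq,
        Finset.mem_insert, Finset.mem_singleton]
      constructor
      · exact And.right
      · rintro (rfl | rfl) <;> simp_all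
    rw [h, Finset.card_pair hmi.symm]
    exact even_two

/-- The local maximization at a check node is bounded by the sum of the edgewise maxima. -/
lemma iSup_Skin_le {VL VR : Type*} [Fintype VL] [DecidableEq VL]
    (Nc : VR → Finset VL) (k : VR) (i : VL) (x : Bool) (hi : i ∈ Nc k)
    (hc : 2 ≤ (Nc k).card) (μ : VL → VR → Bool → ℝ) (M : VL → ℝ)
    (hM : ∀ m ∈ Nc k, ∀ b, μ m k b ≤ M m) :
    ⨆ w : {w : VL → Bool // w ∈ Skin Nc k i x}, ∑ m ∈ (Nc k).erase i, μ m k (w.1 m) ≤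
      ∑ m ∈ (Nc k).erase i, M m := by
  have : Nonempty {w : VL → Bool // w ∈ Skin Nc k i x} :=
    (Skin_nonempty Nc k i x hi hc).to_subtype
  exact ciSup_le fun w => Finset.sum_le_sum fun m hm => hM m (Finset.mem_of_mem_erase hm) _

/-- The edgewise maxima are attained jointly when some locally valid assignment realizes them. -/
lemma iSup_Skin_eq {VL VR : Type*} [Fintype VL] [DecidableEq VL]
    (Nc : VR → Finset VL) (k : VR) (i : VL) (x : Bool) (hi : i ∈ Nc k)
    (hc : 2 ≤ (Nc k).card) (μ : VL → VR → Bool → ℝ) (w : VL → Bool) (hw : w ∈ Skin Nc k i x)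
    (hmax : ∀ m ∈ Nc k, ∀ b, μ m k b ≤ μ m k (w m)) :
    ⨆ w : {w : VL → Bool // w ∈ Skin Nc k i x}, ∑ m ∈ (Nc k).erase i, μ m k (w.1 m) =
      ∑ m ∈ (Nc k).erase i, μ m k (w m) :=
  le_antisymm (iSup_Skin_le Nc k i x hi hc μ _ hmax)
    (le_ciSup (f := fun w : {w : VL → Bool // w ∈ Skin Nc k i x} =>
      ∑ m ∈ (Nc k).erase i, μ m k (w.1 m)) (Set.finite_range _).bddAbove ⟨w, hw⟩)

/-- Bound on the edge-sum of fixed-point AMP values at an arbitrary binary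
edge assignment, with equality at the maximizing assignment when it is AMP-consistent. -/
theorem amp_fixed_point_sum_bound
    {VL VR : Type*} [Fintype VL] [Fintype VR] [DecidableEq VL] [DecidableEq VR]
    [Nonempty VL] [Nonempty VR]
    (Nv : VL → Finset VR) (Nc : VR → Finset VL) (dv dc : ℕ)
    (hsym : ∀ (i : VL) (j : VR), j ∈ Nv i ↔ i ∈ Nc j)
    (hdv : ∀ i : VL, (Nv i).card = dv) (hdc : ∀ j : VR, (Nc j).card = dc)
    (hdv2 : 2 ≤ dv) (hdc2 : 2 ≤ dc)
    (γ : VL → ℝ) (β : ℝ)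
    (hβ0 : 0 ≤ β * ((dv : ℝ) - 1) * ((dc : ℝ) - 1))
    (hβ1 : β * ((dv : ℝ) - 1) * ((dc : ℝ) - 1) < 1)
    (μs : VL → VR → Bool → ℝ)
    (hfix : ∀ i : VL, ∀ j ∈ Nv i, ∀ x : Bool, μs i j x = Aop Nv Nc γ β μs i j x)
    (xs : VL → VR → Bool)
    (hmax : ∀ i : VL, ∀ j ∈ Nv i, ∀ b : Bool, b ≠ xs i j → μs i j b < μs i j (xs i j)) :
    (∀ xa : VL → VR → Bool,
      ∑ p ∈ Edges Nv, μs p.1 p.2 (xa p.1 p.2) ≤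
        ∑ p ∈ Edges Nv, (1 - bv (xa p.1 p.2)) * γ p.1 +
          β * ((dv : ℝ) - 1) * ((dc : ℝ) - 1) * ∑ p ∈ Edges Nv, μs p.1 p.2 (xs p.1 p.2)) ∧
    (AMPConsistent Nv Nc xs →
      ∑ p ∈ Edges Nv, μs p.1 p.2 (xs p.1 p.2) =
        ∑ p ∈ Edges Nv, (1 - bv (xs p.1 p.2)) * γ p.1 +
          β * ((dv : ℝ) - 1) * ((dc : ℝ) - 1) * ∑ p ∈ Edges Nv, μs p.1 p.2 (xs p.1 p.2)) := by
  have hdv1 : (0 : ℝ) < (dv : ℝ) - 1 := by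
    have : (2 : ℝ) ≤ dv := by exact_mod_cast hdv2
    linarith
  have hdc1 : (0 : ℝ) < (dc : ℝ) - 1 := by
    have : (2 : ℝ) ≤ dc := by exact_mod_cast hdc2
    linarith
  have hβ : 0 ≤ β := by
    rw [mul_assoc] at hβ0
    exact nonneg_of_mul_nonneg_left hβ0 (mul_pos hdv1 hdc1)
  have hc : ∀ k, 2 ≤ (Nc k).card := fun k => (hdc k).symm ▸ hdc2
  have hle : ∀ k, ∀ m ∈ Nc k, ∀ b, μs m k b ≤ μs m k (xs m k) := by
    intro k m hm b
    by_cases hb : b = xs m k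
    · rw [hb]
    · exact (hmax m k ((hsym m k).2 hm) b hb).le
  have hsum : ∑ p ∈ Edges Nv, β * ∑ k ∈ (Nv p.1).erase p.2,
      ∑ m ∈ (Nc k).erase p.1, μs m k (xs m k) =
      β * ((dv : ℝ) - 1) * ((dc : ℝ) - 1) * ∑ p ∈ Edges Nv, μs p.1 p.2 (xs p.1 p.2) := by
    rw [← Finset.mul_sum, sum_extrinsic Nv Nc dv dc hsym hdv hdc fun m k => μs m k (xs m k)]
    ring
  have hedge : ∀ p ∈ Edges Nv, p.2 ∈ Nv p.1 := fun p hp => (Finset.mem_filter.1 hp).2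
  rw [← hsum]
  refine ⟨fun xa => ?_, fun hcons => ?_⟩
  · rw [← Finset.sum_add_distrib]
    refine Finset.sum_le_sum fun p hp => ?_
    rw [hfix p.1 p.2 (hedge p hp), Aop]
    gcongr with k hk
    exact iSup_Skin_le Nc k p.1 _ ((hsym _ _).1 (Finset.mem_of_mem_erase hk)) (hc k) μs _ (hle k)
  · obtain ⟨hcommon, heven⟩ := hcons
    have hw : ∀ m, ∀ k ∈ Nv m, decide (∀ j ∈ Nv m, xs m j = true) = xs m k := by
      intro m k hk
      rw [Bool.eq_iff_iff, decide_eq_true_eq]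
      exact ⟨fun h => h k hk, fun h j hj => (hcommon m j hj k hk).trans h⟩
    rw [← Finset.sum_add_distrib]
    refine Finset.sum_congr rfl fun p hp => ?_
    conv_lhs => rw [hfix p.1 p.2 (hedge p hp), Aop]
    congr 2
    refine Finset.sum_congr rfl fun k hk => ?_
    have hwk : ∀ m ∈ Nc k, decide (∀ j ∈ Nv m, xs m j = true) = xs m k :=
      fun m hm => hw m k ((hsym m k).2 hm)
    rw [iSup_Skin_eq Nc k p.1 _ ((hsym _ _).1 (Finset.mem_of_mem_erase hk)) (hc k) μs
      (fun m => decide (∀ j ∈ Nv m, xs m j = true))]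
    · exact Finset.sum_congr rfl fun m hm => by rw [hwk m (Finset.mem_of_mem_erase hm)]
    · rw [Skin, Finset.mem_filter]
      exact ⟨Finset.mem_univ _, hw _ _ (hedge p hp), by
        convert heven k using 4
        simp⟩
    · intro m hm b
      rw [hwk m hm]
      exact hle k m hm b
end

section
/- Let β ≥ 0 and let μ ∈ ℝ^E be a WMS-consistent message vector (with parameter β). Then the hard decision vector x̂ ∈ {0,1}^{V_L}, defined by x̂_i = (1 − sgn(γ_i + β·Σ_{j∈N(i)} μ_{i←j}))/2, is a codeword, i.e., Σ_{i∈N(j)} x̂_i ≡ 0 (mod 2) for every check node j ∈ V_R. -/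
open Finset Filter

/-- Check-to-bit message computed from a WMS message vector `μ`:
`μ_{i←k} = (Π_{m∈N(k)\{i}} sgn(μ_{m→k})) · min_{m∈N(k)\{i}} |μ_{m→k}|`. -/
noncomputable def c2b {VL VR : Type*} [DecidableEq VL]
    (Nc : VR → Finset VL) (μ : VL → VR → ℝ) (i : VL) (k : VR) : ℝ :=
  (∏ m ∈ (Nc k).erase i, Real.sign (μ m k)) *
    ⨅ m : {m : VL // m ∈ (Nc k).erase i}, |μ m.1 k|

/-- The weighted min-sum operator `W_β`:
`(W_β[μ])_{i→j} = γ_i + β·Σ_{k∈N(i)\{j}} μ_{i←k}`. -/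
noncomputable def Wop {VL VR : Type*} [DecidableEq VL] [DecidableEq VR]
    (Nv : VL → Finset VR) (Nc : VR → Finset VL) (γ : VL → ℝ) (β : ℝ)
    (μ : VL → VR → ℝ) : VL → VR → ℝ :=
  fun i j => γ i + β * ∑ k ∈ (Nv i).erase j, c2b Nc μ i k

/-- The WMS iterates, initialized with the channel LLRs: `μ^{(0)}_{i→j} = γ_i`,
`μ^{(ℓ+1)} = W_β[μ^{(ℓ)}]`. -/
noncomputable def wmsIter {VL VR : Type*} [DecidableEq VL] [DecidableEq VR]
    (Nv : VL → Finset VR) (Nc : VR → Finset VL) (γ : VL → ℝ) (β : ℝ) :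
    ℕ → VL → VR → ℝ :=
  fun n => (Wop Nv Nc γ β)^[n] (fun i _ => γ i)

/-- WMS-consistency of a message vector (with parameter `β`). -/
def WMSConsistent {VL VR : Type*} [DecidableEq VL] [DecidableEq VR]
    (Nv : VL → Finset VR) (Nc : VR → Finset VL) (γ : VL → ℝ) (β : ℝ)
    (μ : VL → VR → ℝ) : Prop :=
  (∀ i : VL, ∀ j ∈ Nv i, μ i j ≠ 0) ∧
  (∀ i : VL, ∀ j ∈ Nv i, ∀ j' ∈ Nv i, Real.sign (μ i j) = Real.sign (μ i j')) ∧
  (∀ i : VL, ∀ j ∈ Nv i, Real.sign (c2b Nc μ i j) = Real.sign (μ i j)) ∧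
  (∀ i : VL, ∀ j' ∈ Nv i,
    Real.sign (γ i + β * ∑ j ∈ Nv i, c2b Nc μ i j) = Real.sign (μ i j'))

/-- Hard decisions computed from a WMS message vector:
`x̂_i = (1 − sgn(γ_i + β·Σ_{j∈N(i)} μ_{i←j}))/2`. -/
noncomputable def hardDec {VL VR : Type*} [DecidableEq VL]
    (Nv : VL → Finset VR) (Nc : VR → Finset VL) (γ : VL → ℝ) (β : ℝ)
    (μ : VL → VR → ℝ) : VL → ℝ :=
  fun i => (1 - Real.sign (γ i + β * ∑ j ∈ Nv i, c2b Nc μ i j)) / 2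

/-- Sup-norm over edges of an edge-indexed family of reals. -/
noncomputable def edgeSup {VL VR : Type*} (Nv : VL → Finset VR) (f : VL → VR → ℝ) : ℝ :=
  ⨆ p : {q : VL × VR // q.2 ∈ Nv q.1}, |f p.1.1 p.1.2|

/-- Sup-norm `‖γ‖_∞` of the LLR vector. -/
noncomputable def gammaSup {VL : Type*} (γ : VL → ℝ) : ℝ := ⨆ i, |γ i|

/-- A codeword, as a real vector with entries in `{0, 1}` whose sum over each check
neighborhood is even. -/
def IsCodewordR {VL VR : Type*} (Nc : VR → Finset VL) (x : VL → ℝ) : Prop :=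
  (∀ i, x i = 0 ∨ x i = 1) ∧ ∀ j : VR, ∃ m : ℤ, ∑ i ∈ Nc j, x i = 2 * m

/-- For a family of signs over `S`, the parity of the number of negative entries is recorded by
their product. -/
lemma prod_sign_and_parity {ι : Type*} [DecidableEq ι] (S : Finset ι) (s : ι → ℝ)
    (hs : ∀ i ∈ S, s i = 1 ∨ s i = -1) :
    (∏ i ∈ S, s i = 1 ∧ ∃ m : ℤ, ∑ i ∈ S, (1 - s i) / 2 = 2 * m) ∨
      (∏ i ∈ S, s i = -1 ∧ ∃ m : ℤ, ∑ i ∈ S, (1 - s i) / 2 = 2 * m + 1) := by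
  induction S using Finset.induction_on with
  | empty => exact Or.inl ⟨by simp, 0, by simp⟩
  | insert a T ha ih =>
    rw [Finset.prod_insert ha, Finset.sum_insert ha]
    have hT := ih fun i hi => hs i (Finset.mem_insert_of_mem hi)
    rcases hs a (Finset.mem_insert_self a T) with h | h <;>
      rcases hT with ⟨hp, m, hm⟩ | ⟨hp, m, hm⟩ <;> rw [h, hp, hm]
    · exact Or.inl ⟨by norm_num, m, by ring⟩
    · exact Or.inr ⟨by norm_num, m, by ring⟩
    · exact Or.inr ⟨by norm_num, m, by ring⟩
    · exact Or.inl ⟨by norm_num, m + 1, by push_cast; ring⟩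

lemma sign_eq_one_or_neg_one {x : ℝ} (hx : x ≠ 0) : Real.sign x = 1 ∨ Real.sign x = -1 :=
  (Real.sign_apply_eq_of_ne_zero x hx).symm

/-- A nonzero check-to-bit message has as its sign the product of the incoming signs. -/
lemma sign_c2b {VL VR : Type*} [DecidableEq VL] (Nc : VR → Finset VL) (μ : VL → VR → ℝ)
    (i : VL) (k : VR) (hμ : ∀ m ∈ Nc k, μ m k ≠ 0) (h : c2b Nc μ i k ≠ 0) :
    Real.sign (c2b Nc μ i k) = ∏ m ∈ (Nc k).erase i, Real.sign (μ m k) := by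
  unfold c2b at h ⊢
  have hmin : 0 < ⨅ m : {m : VL // m ∈ (Nc k).erase i}, |μ m.1 k| :=
    lt_of_le_of_ne (Real.iInf_nonneg fun _ => abs_nonneg _) (right_ne_zero_of_mul h).symm
  rcases prod_sign_and_parity ((Nc k).erase i) (fun m => Real.sign (μ m k))
      (fun m hm => sign_eq_one_or_neg_one (hμ m (Finset.mem_of_mem_erase hm)))
    with ⟨hp, -⟩ | ⟨hp, -⟩
  · rw [hp, one_mul, Real.sign_of_pos hmin]
  · rw [hp, neg_one_mul, Real.sign_of_neg (neg_lt_zero.mpr hmin)]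

/-- If a WMS message vector is WMS-consistent, then its hard decision
vector is a codeword. -/
theorem wms_consistent_hard_decision_is_codeword
    {VL VR : Type*} [Fintype VL] [Fintype VR] [DecidableEq VL] [DecidableEq VR]
    [Nonempty VL] [Nonempty VR]
    (Nv : VL → Finset VR) (Nc : VR → Finset VL) (dv dc : ℕ)
    (hsym : ∀ (i : VL) (j : VR), j ∈ Nv i ↔ i ∈ Nc j)
    (hdv : ∀ i : VL, (Nv i).card = dv) (hdc : ∀ j : VR, (Nc j).card = dc)
    (hdv2 : 2 ≤ dv) (hdc2 : 2 ≤ dc)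
    (γ : VL → ℝ) (β : ℝ) (hβ : 0 ≤ β)
    (μ : VL → VR → ℝ) (hcons : WMSConsistent Nv Nc γ β μ) :
    IsCodewordR Nc (hardDec Nv Nc γ β μ) := by
  obtain ⟨hne, -, hc2b, hdec⟩ := hcons
  refine ⟨fun i => ?_, fun j => ?_⟩
  · obtain ⟨j, hj⟩ : (Nv i).Nonempty := Finset.card_pos.mp (by rw [hdv i]; omega)
    unfold hardDec
    rw [hdec i j hj]
    rcases sign_eq_one_or_neg_one (hne i j hj) with h | h <;> rw [h] <;> norm_num
  · have hμ : ∀ i ∈ Nc j, μ i j ≠ 0 := fun i hi => hne i j ((hsym i j).mpr hi)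
    have hsum : ∑ i ∈ Nc j, hardDec Nv Nc γ β μ i =
        ∑ i ∈ Nc j, (1 - Real.sign (μ i j)) / 2 :=
      Finset.sum_congr rfl fun i hi => by
        unfold hardDec
        rw [hdec i j ((hsym i j).mpr hi)]
    obtain ⟨i, hi⟩ : (Nc j).Nonempty := Finset.card_pos.mp (by rw [hdc j]; omega)
    have hsign := hc2b i j ((hsym i j).mpr hi)
    have hc : c2b Nc μ i j ≠ 0 := fun h0 => by
      rw [h0, Real.sign_zero, eq_comm, Real.sign_eq_zero_iff] at hsign
      exact hμ i hi hsign
    have hprod : ∏ m ∈ Nc j, Real.sign (μ m j) = 1 := by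
      rw [← Finset.mul_prod_erase _ _ hi, ← sign_c2b Nc μ i j hμ hc, hsign]
      rcases sign_eq_one_or_neg_one (hμ i hi) with h | h <;> rw [h] <;> norm_num
    rw [hsum]
    rcases prod_sign_and_parity (Nc j) (fun m => Real.sign (μ m j))
        (fun m hm => sign_eq_one_or_neg_one (hμ m hm)) with ⟨-, hm⟩ | ⟨hp, -⟩
    · exact hm
    · exact absurd (hprod.symm.trans hp) (by norm_num)
end

section
/- Let μ, ν ∈ ℝ^E be two WMS message vectors, let k ∈ V_R be a check node and i ∈ N(k). Define d_{i,k} = | (Π_{m∈N(k)\{i}} sgn(μ_{m→k}))·min_{m∈N(k)\{i}} |μ_{m→k}| − (Π_{m∈N(k)\{i}} sgn(ν_{m→k}))·min_{m∈N(k)\{i}} |ν_{m→k}| |. Then max_{m∈N(k)\{i}} |μ_{m→k} − ν_{m→k}| ≥ d_{i,k}. -/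
open Finset Filter

theorem Real.abs_sign_le_one (x : ℝ) : |Real.sign x| ≤ 1 := by
  rcases Real.sign_apply_eq x with h | h | h <;> simp [h]

theorem Real.abs_sub_eq_abs_add_abs_of_sign_ne {x y : ℝ} (h : Real.sign x ≠ Real.sign y) :
    |x - y| = |x| + |y| := by
  rcases lt_trichotomy x 0 with hx | rfl | hx <;> rcases lt_trichotomy y 0 with hy | rfl | hy
  · simp [Real.sign_of_neg, hx, hy] at h
  · simp
  · rw [abs_of_neg hx, abs_of_pos hy, abs_of_neg (by linarith)]; ring
  · simp
  · simp
  · simp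
  · rw [abs_of_pos hx, abs_of_neg hy, abs_of_pos (by linarith)]; ring
  · simp
  · simp [Real.sign_of_pos, hx, hy] at h

theorem Finset.abs_prod_sign_le_one {ι : Type*} (s : Finset ι) (f : ι → ℝ) :
    |∏ m ∈ s, Real.sign (f m)| ≤ 1 := by
  rw [Finset.abs_prod]
  exact Finset.prod_le_one (fun _ _ => abs_nonneg _) fun _ _ => Real.abs_sign_le_one _

theorem ciInf_abs_le_ciInf_abs_add {ι : Type*} [Finite ι] [Nonempty ι] {f g : ι → ℝ} {D : ℝ}
    (hD : ∀ m, |f m - g m| ≤ D) : ⨅ m, |f m| ≤ (⨅ m, |g m|) + D := by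
  rw [← sub_le_iff_le_add]
  refine le_ciInf fun m => ?_
  have h₁ : ⨅ m, |f m| ≤ |f m| := ciInf_le (Set.finite_range _).bddBelow m
  have h₂ := abs_sub_abs_le_abs_sub (f m) (g m)
  linarith [hD m]

/-- The signed minimum `(∏ sgn f) · min |f|` over a finite nonempty index set is nonexpansive
in the sup norm. -/
theorem abs_signed_min_sub_signed_min_le {ι : Type*} [Fintype ι] [Nonempty ι] {f g : ι → ℝ}
    {D : ℝ} (hD : ∀ m, |f m - g m| ≤ D) :
    |(∏ m, Real.sign (f m)) * (⨅ m, |f m|) - (∏ m, Real.sign (g m)) * (⨅ m, |g m|)| ≤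
      D := by
  by_cases h : ∀ m, Real.sign (f m) = Real.sign (g m)
  · have hfg : |(⨅ m, |f m|) - (⨅ m, |g m|)| ≤ D := by
      have h₁ := ciInf_abs_le_ciInf_abs_add hD
      have h₂ := ciInf_abs_le_ciInf_abs_add fun m => (abs_sub_comm (g m) (f m)).trans_le (hD m)
      rw [abs_le]
      constructor <;> linarith
    simp only [h]
    rw [← mul_sub, abs_mul]
    exact (mul_le_of_le_one_left (abs_nonneg _) (Finset.abs_prod_sign_le_one _ g)).trans hfg
  · push Not at h
    obtain ⟨m, hm⟩ := h
    have bound (u : ι → ℝ) : |(∏ m, Real.sign (u m)) * (⨅ m, |u m|)| ≤ |u m| := by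
      have hnonneg : 0 ≤ ⨅ m, |u m| := Real.iInf_nonneg fun _ => abs_nonneg _
      rw [abs_mul, abs_of_nonneg hnonneg]
      exact (mul_le_of_le_one_left hnonneg (Finset.abs_prod_sign_le_one _ u)).trans
        (ciInf_le (Set.finite_range _).bddBelow m)
    calc _ ≤ _ := abs_sub _ _
      _ ≤ |f m| + |g m| := add_le_add (bound f) (bound g)
      _ = |f m - g m| := (Real.abs_sub_eq_abs_add_abs_of_sign_ne hm).symm
      _ ≤ D := hD m

/-- The check-node update is nonexpansive: the difference of check-to-bit
values computed from two message vectors is bounded by the max difference of incoming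
messages. -/
theorem wms_check_node_nonexpansive
    {VL VR : Type*} [Fintype VL] [Fintype VR] [DecidableEq VL] [DecidableEq VR]
    [Nonempty VL] [Nonempty VR]
    (Nv : VL → Finset VR) (Nc : VR → Finset VL) (dv dc : ℕ)
    (hsym : ∀ (i : VL) (j : VR), j ∈ Nv i ↔ i ∈ Nc j)
    (hdv : ∀ i : VL, (Nv i).card = dv) (hdc : ∀ j : VR, (Nc j).card = dc)
    (hdv2 : 2 ≤ dv) (hdc2 : 2 ≤ dc)
    (μ ν : VL → VR → ℝ) (k : VR) (i : VL) (hik : i ∈ Nc k) :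
    |c2b Nc μ i k - c2b Nc ν i k| ≤
      ⨆ m : {m : VL // m ∈ (Nc k).erase i}, |μ m.1 k - ν m.1 k| := by
  have hne : ((Nc k).erase i).Nonempty := by
    rw [← Finset.card_pos, Finset.card_erase_of_mem hik, hdc k]
    omega
  have : Nonempty {m : VL // m ∈ (Nc k).erase i} := hne.to_subtype
  unfold c2b
  rw [← Finset.prod_coe_sort _ fun m => Real.sign (μ m k),
    ← Finset.prod_coe_sort _ fun m => Real.sign (ν m k)]
  exact abs_signed_min_sub_signed_min_le fun m =>
    le_ciSup (f := fun m : {m : VL // m ∈ (Nc k).erase i} => |μ m.1 k - ν m.1 k|)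
      (Set.finite_range _).bddAbove m
end

section
/- Let β ≥ 0 and let μ* ∈ ℝ^E be a fixed point of the WMS operator W_β, with check-to-bit values μ*_{i←j}. Define τ*_{i,j} = (μ*_{i→j} − β(d_v−1)·μ*_{i←j})/d_v for each edge (i,j) ∈ E. Then for every variable node i ∈ V_L, Σ_{j∈N(i)} τ*_{i,j} = γ_i; i.e., τ* is a feasible point of the dual of the LP decoding problem. -/
open Finset Filter

/-- For a fixed point `μ*` of the WMS operator, the assignment
`τ*_{i,j} = (μ*_{i→j} − β(d_v−1)·μ*_{i←j})/d_v` satisfies `Σ_{j∈N(i)} τ*_{i,j} = γ_i`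
for every variable node `i`, i.e. it is a feasible point of the dual LP. -/
theorem wms_fixed_point_dual_feasible
    {VL VR : Type*} [Fintype VL] [Fintype VR] [DecidableEq VL] [DecidableEq VR]
    [Nonempty VL] [Nonempty VR]
    (Nv : VL → Finset VR) (Nc : VR → Finset VL) (dv dc : ℕ)
    (hsym : ∀ (i : VL) (j : VR), j ∈ Nv i ↔ i ∈ Nc j)
    (hdv : ∀ i : VL, (Nv i).card = dv) (hdc : ∀ j : VR, (Nc j).card = dc)
    (hdv2 : 2 ≤ dv) (hdc2 : 2 ≤ dc)
    (γ : VL → ℝ) (β : ℝ) (hβ : 0 ≤ β)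
    (μs : VL → VR → ℝ)
    (hfix : ∀ i : VL, ∀ j ∈ Nv i, μs i j = Wop Nv Nc γ β μs i j) :
    ∀ i : VL, ∑ j ∈ Nv i, (μs i j - β * ((dv : ℝ) - 1) * c2b Nc μs i j) / (dv : ℝ) = γ i := by
  intro i
  set c : VR → ℝ := c2b Nc μs i
  have hdv0 : (dv : ℝ) ≠ 0 := by
    have : dv ≠ 0 := by omega
    exact_mod_cast this
  have hμ : ∀ j ∈ Nv i, μs i j = γ i + β * (∑ k ∈ Nv i, c k) - β * c j := by
    intro j hj
    rw [hfix i j hj, Wop, ← Finset.add_sum_erase _ _ hj]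
    ring
  rw [← Finset.sum_div, div_eq_iff hdv0, Finset.sum_sub_distrib, ← Finset.mul_sum,
    Finset.sum_congr rfl hμ, Finset.sum_sub_distrib, ← Finset.mul_sum, Finset.sum_const,
    hdv i, nsmul_eq_mul]
  ring
end

section
/- Let 0 ≤ β with β(d_v−1) < 1, let μ* ∈ ℝ^E be a WMS-consistent fixed point of the WMS operator W_β, and define τ*_{i,j} = (μ*_{i→j} − β(d_v−1)·μ*_{i←j})/d_v for each edge (i,j) ∈ E. Then for every check node j ∈ V_R, the binary vector w* : N(j) → {0,1} given by w*_i = (1 − sgn(μ*_{i→j}))/2 minimizes Σ_{i∈N(j)} w_i·τ*_{i,j} over all binary vectors w : N(j) → {0,1} with Σ_{i∈N(j)} w_i even. -/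
open Finset Filter

/-- If the values of `f` at any two distinct points have nonnegative sum, then so does `f` over any
finite set which is not a singleton. -/
theorem sum_nonneg_of_pairwise_add_nonneg {ι : Type*} [DecidableEq ι] (s : Finset ι) (f : ι → ℝ)
    (hpair : ∀ i ∈ s, ∀ k ∈ s, i ≠ k → 0 ≤ f i + f k) (hcard : s.card ≠ 1) :
    0 ≤ ∑ i ∈ s, f i := by
  by_cases hf : ∀ i ∈ s, 0 ≤ f i
  · exact sum_nonneg hf
  push Not at hf
  obtain ⟨i, hi, hfi⟩ := hf
  have hne : (s.erase i).Nonempty := by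
    rw [← card_pos, card_erase_of_mem hi]
    have := card_pos.2 ⟨i, hi⟩
    omega
  obtain ⟨k, hk⟩ := hne
  have hnonneg : ∀ m ∈ s.erase i, 0 ≤ f m := fun m hm => by
    linarith [hpair i hi m (mem_of_mem_erase hm) (ne_of_mem_erase hm).symm]
  have hle := single_le_sum hnonneg hk
  have hik := hpair i hi k (mem_of_mem_erase hk) (ne_of_mem_erase hk).symm
  linarith [add_sum_erase s f hi]

theorem prod_ite_neg_one_eq_one_iff_even {ι : Type*} (s : Finset ι) (p : ι → Prop)
    [DecidablePred p] :
    ∏ i ∈ s, (if p i then (-1 : ℝ) else 1) = 1 ↔ Even (s.filter p).card := by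
  simp [prod_ite, neg_one_pow_eq_one_iff_even (show (-1 : ℝ) ≠ 1 by norm_num)]

theorem iInf_abs_erase_le {VL VR : Type*} [DecidableEq VL] (Nc : VR → Finset VL)
    (μ : VL → VR → ℝ) {i m : VL} {j : VR} (hm : m ∈ Nc j) (hmi : m ≠ i) :
    ⨅ m : {m : VL // m ∈ (Nc j).erase i}, |μ m.1 j| ≤ |μ m j| :=
  ciInf_le (f := fun m : {m : VL // m ∈ (Nc j).erase i} => |μ m.1 j|)
    ⟨0, by rintro _ ⟨m, rfl⟩; exact abs_nonneg _⟩ ⟨m, mem_erase.2 ⟨hmi, hm⟩⟩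

theorem real_sign_mul (x y : ℝ) : Real.sign (x * y) = Real.sign x * Real.sign y := by
  rcases lt_trichotomy x 0 with hx | rfl | hx <;> rcases lt_trichotomy y 0 with hy | rfl | hy <;>
    simp [Real.sign_of_neg, Real.sign_of_pos, mul_pos_of_neg_of_neg, mul_neg_of_pos_of_neg,
      mul_neg_of_neg_of_pos, *]

theorem real_sign_mul_abs (x : ℝ) : Real.sign x * |x| = x := by
  rcases lt_trichotomy x 0 with hx | rfl | hx <;>
    simp [Real.sign_of_neg, Real.sign_of_pos, abs_of_neg, abs_of_pos, *]

theorem prod_sign_eq_sign_prod {ι : Type*} (s : Finset ι) (f : ι → ℝ) :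
    ∏ i ∈ s, Real.sign (f i) = Real.sign (∏ i ∈ s, f i) := by
  classical
  induction s using Finset.induction_on with
  | empty => simp
  | insert a s ha ih => rw [prod_insert ha, prod_insert ha, ih, real_sign_mul]

/-- If the check-to-bit message has the sign of a nonzero message, then so does the product of the
other incoming signs. -/
theorem prod_sign_erase_eq_sign {VL VR : Type*} [DecidableEq VL] (Nc : VR → Finset VL)
    (μ : VL → VR → ℝ) {i : VL} {j : VR} (hμ : μ i j ≠ 0)
    (hsign : Real.sign (c2b Nc μ i j) = Real.sign (μ i j)) :
    ∏ m ∈ (Nc j).erase i, Real.sign (μ m j) = Real.sign (μ i j) := by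
  have hc : c2b Nc μ i j ≠ 0 := by
    rwa [Ne, ← Real.sign_eq_zero_iff, hsign, Real.sign_eq_zero_iff]
  have hpos : 0 < ⨅ m : {m : VL // m ∈ (Nc j).erase i}, |μ m.1 j| :=
    (Real.iInf_nonneg fun _ => abs_nonneg _).lt_of_ne' (right_ne_zero_of_mul hc)
  rw [← hsign, c2b, real_sign_mul, Real.sign_of_pos hpos, mul_one, prod_sign_eq_sign_prod]
  rcases Real.sign_apply_eq (∏ m ∈ (Nc j).erase i, μ m j) with h | h | h <;>
    simp [h, Real.sign_neg]

/-- Distinct edges at a check have check-to-bit magnitudes dominated by each other's messages, so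
the sign-normalized dual values `|μ_i| - c · min_{m ≠ i} |μ_m|` add up to a nonnegative number. -/
theorem pair_abs_sub_iInf_nonneg {VL VR : Type*} [DecidableEq VL] (Nc : VR → Finset VL)
    (μ : VL → VR → ℝ) {c : ℝ} (hc0 : 0 ≤ c) (hc1 : c ≤ 1) {i k : VL} {j : VR}
    (hi : i ∈ Nc j) (hk : k ∈ Nc j) (hik : i ≠ k) :
    0 ≤ (|μ i j| - c * ⨅ m : {m : VL // m ∈ (Nc j).erase i}, |μ m.1 j|) +
      (|μ k j| - c * ⨅ m : {m : VL // m ∈ (Nc j).erase k}, |μ m.1 j|) := by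
  have h₁ := mul_le_mul_of_nonneg_left (iInf_abs_erase_le Nc μ hk hik.symm) hc0
  have h₂ := mul_le_mul_of_nonneg_left (iInf_abs_erase_le Nc μ hi hik) hc0
  have h₃ := mul_le_of_le_one_left (abs_nonneg (μ i j)) hc1
  have h₄ := mul_le_of_le_one_left (abs_nonneg (μ k j)) hc1
  linarith

/-- For a WMS-consistent fixed point with `β(d_v−1) < 1`, at every check
node `j` the binary vector `w*_i = (1 − sgn(μ*_{i→j}))/2` is an even-weight binary vector
minimizing `Σ_{i∈N(j)} w_i·τ*_{i,j}` over all even-weight binary vectors on `N(j)`, where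
`τ*_{i,j} = (μ*_{i→j} − β(d_v−1)·μ*_{i←j})/d_v`. -/
theorem wms_hard_decision_minimizes_local_dual
    {VL VR : Type*} [Fintype VL] [Fintype VR] [DecidableEq VL] [DecidableEq VR]
    [Nonempty VL] [Nonempty VR]
    (Nv : VL → Finset VR) (Nc : VR → Finset VL) (dv dc : ℕ)
    (hsym : ∀ (i : VL) (j : VR), j ∈ Nv i ↔ i ∈ Nc j)
    (hdv : ∀ i : VL, (Nv i).card = dv) (hdc : ∀ j : VR, (Nc j).card = dc)
    (hdv2 : 2 ≤ dv) (hdc2 : 2 ≤ dc)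
    (γ : VL → ℝ) (β : ℝ) (hβ0 : 0 ≤ β) (hβ1 : β * ((dv : ℝ) - 1) < 1)
    (μs : VL → VR → ℝ)
    (hfix : ∀ i : VL, ∀ j ∈ Nv i, μs i j = Wop Nv Nc γ β μs i j)
    (hcons : WMSConsistent Nv Nc γ β μs)
    (j : VR) :
    (∀ i ∈ Nc j, (1 - Real.sign (μs i j)) / 2 = 0 ∨ (1 - Real.sign (μs i j)) / 2 = 1) ∧
    (∃ m : ℤ, ∑ i ∈ Nc j, (1 - Real.sign (μs i j)) / 2 = 2 * m) ∧
    (∀ w : VL → Bool, Even (((Nc j).filter (fun i => w i = true)).card) →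
      ∑ i ∈ Nc j, ((1 - Real.sign (μs i j)) / 2) *
          ((μs i j - β * ((dv : ℝ) - 1) * c2b Nc μs i j) / (dv : ℝ))
        ≤ ∑ i ∈ Nc j, (if w i then (1 : ℝ) else 0) *
            ((μs i j - β * ((dv : ℝ) - 1) * c2b Nc μs i j) / (dv : ℝ))) := by
  obtain ⟨hne, -, hsign, -⟩ := hcons
  have hμ : ∀ i ∈ Nc j, μs i j ≠ 0 := fun i hi => hne i j ((hsym i j).2 hi)
  have hs : ∀ i ∈ Nc j, Real.sign (μs i j) = -1 ∨ Real.sign (μs i j) = 1 := fun i hi =>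
    Real.sign_apply_eq_of_ne_zero _ (hμ i hi)
  have herase : ∀ i ∈ Nc j, ∏ m ∈ (Nc j).erase i, Real.sign (μs m j) = Real.sign (μs i j) :=
    fun i hi => prod_sign_erase_eq_sign Nc μs (hμ i hi) (hsign i j ((hsym i j).2 hi))
  have hprod : ∏ i ∈ Nc j, Real.sign (μs i j) = 1 := by
    obtain ⟨i, hi⟩ : (Nc j).Nonempty := by
      rw [← card_pos, hdc j]
      omega
    rw [← mul_prod_erase _ _ hi, herase i hi]
    rcases hs i hi with h | h <;> simp [h]
  refine ⟨fun i hi => ?_, ?_, fun w hw => ?_⟩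
  · rcases hs i hi with h | h <;> norm_num [h]
  · have heven : Even ((Nc j).filter (fun i => Real.sign (μs i j) = -1)).card := by
      rw [← prod_ite_neg_one_eq_one_iff_even]
      refine Eq.trans ?_ hprod
      refine prod_congr rfl fun i hi => ?_
      rcases hs i hi with h | h <;> norm_num [h]
    obtain ⟨n, hn⟩ := heven
    refine ⟨n, ?_⟩
    have hsum : ∑ i ∈ Nc j, (1 - Real.sign (μs i j)) / 2 =
        ((Nc j).filter (fun i => Real.sign (μs i j) = -1)).card := by
      rw [← sum_boole]
      refine sum_congr rfl fun i hi => ?_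
      rcases hs i hi with h | h <;> norm_num [h]
    rw [hsum, hn]
    push_cast
    ring
  · set c : ℝ := β * ((dv : ℝ) - 1)
    have hdv1 : (1 : ℝ) ≤ dv := by exact_mod_cast (show 1 ≤ dv by omega)
    have hc0 : 0 ≤ c := mul_nonneg hβ0 (by linarith)
    set t : VL → ℝ := fun i =>
      |μs i j| - c * ⨅ m : {m : VL // m ∈ (Nc j).erase i}, |μs m.1 j| with ht
    set D : Finset VL := (Nc j).filter fun i => w i = true ↔ Real.sign (μs i j) = 1 with hD
    have hDeven : Even D.card := by
      rw [← prod_ite_neg_one_eq_one_iff_even] at hw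
      rw [hD, ← prod_ite_neg_one_eq_one_iff_even]
      refine Eq.trans ?_ ((congrArg₂ (· * ·) hw hprod).trans (one_mul 1))
      rw [← prod_mul_distrib]
      refine prod_congr rfl fun i hi => ?_
      rcases hs i hi with h | h <;> cases w i <;> norm_num [h]
    have hDsum : 0 ≤ ∑ i ∈ D, t i :=
      sum_nonneg_of_pairwise_add_nonneg D t
        (fun i hi k hk hik => pair_abs_sub_iInf_nonneg Nc μs hc0 hβ1.le
          (mem_of_mem_filter i hi) (mem_of_mem_filter k hk) hik)
        (fun h => by simp [h] at hDeven)
    rw [← sub_nonneg, ← sum_sub_distrib]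
    refine (div_nonneg hDsum (by linarith : (0 : ℝ) ≤ dv)).trans_eq ?_
    rw [hD, sum_filter, sum_div]
    refine sum_congr rfl fun i hi => ?_
    have hτ : μs i j - c * c2b Nc μs i j = Real.sign (μs i j) * t i := by
      rw [c2b, herase i hi, ht]
      nth_rewrite 1 [← real_sign_mul_abs (μs i j)]
      ring
    rw [hτ]
    rcases hs i hi with h | h <;> cases w i <;> norm_num [h]
    ring
end

section
/- Let 0 ≤ β with β(d_v−1) < 1 and let μ* ∈ ℝ^E be a WMS-consistent fixed point of the WMS operator W_β. Then the hard decision vector x* ∈ {0,1}^{V_L} with x*_i = (1 − sgn(γ_i + β·Σ_{j∈N(i)} μ*_{i←j}))/2 is a codeword, and it is optimal for LP decoding: Σ_{i∈V_L} γ_i x*_i ≤ Σ_{i∈V_L} γ_i z_i for every z in the fundamental polytope P. In particular, Σ_{i∈V_L} γ_i x*_i ≤ Σ_{i∈V_L} γ_i x_i for every codeword x, so x* is a maximum-likelihood codeword. -/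
open Finset Filter

/-- Membership in the fundamental polytope: `z ∈ [0,1]^{V_L}` and, at every check node `j`,
the restriction of `z` to `N(j)` is a convex combination of even-weight binary vectors. -/
def InPolytope {VL VR : Type*} [Fintype VL] [DecidableEq VL]
    (Nc : VR → Finset VL) (z : VL → ℝ) : Prop :=
  (∀ i, 0 ≤ z i ∧ z i ≤ 1) ∧
  ∀ j : VR, ∃ α : (VL → Bool) → ℝ,
    (∀ w, 0 ≤ α w) ∧
    (∀ w, α w ≠ 0 → Even (((Nc j).filter (fun i => w i = true)).card)) ∧
    (∑ w : VL → Bool, α w) = 1 ∧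
    (∀ i ∈ Nc j, z i = ∑ w : VL → Bool, α w * (if w i then (1 : ℝ) else 0))

/-- At a check node whose weights satisfy `y i ≤ ∑_{m ≠ i} y m`, the sum of the weighted gaps
`f i - b · min_{m ≠ i} f m` is nonnegative. -/
theorem sum_mul_sub_iInf_erase_nonneg {ι : Type*} [DecidableEq ι] (S : Finset ι)
    (hS : 2 ≤ S.card) (f y : ι → ℝ) (b : ℝ) (hb0 : 0 ≤ b) (hb1 : b < 1)
    (hf : ∀ i, 0 ≤ f i) (hy : ∀ i ∈ S, 0 ≤ y i)
    (hyS : ∀ i ∈ S, y i ≤ ∑ m ∈ S.erase i, y m) :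
    0 ≤ ∑ i ∈ S, y i * (f i - b * ⨅ m : {m : ι // m ∈ S.erase i}, f m.1) := by
  have hne : S.Nonempty := Finset.card_pos.mp (by omega)
  obtain ⟨i₀, hi₀, hmin⟩ := S.exists_min_image f hne
  have hle : ∀ i, ∀ m ∈ S.erase i, (⨅ m : {m : ι // m ∈ S.erase i}, f m.1) ≤ f m := by
    intro i m hm
    exact ciInf_le (f := fun m : {m : ι // m ∈ S.erase i} => f m.1)
      ⟨0, by rintro _ ⟨m, rfl⟩; exact hf m.1⟩ ⟨m, hm⟩
  rw [← Finset.add_sum_erase S _ hi₀]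
  set M := ⨅ m : {m : ι // m ∈ S.erase i₀}, f m.1
  have hMmin : f i₀ ≤ M := by
    have hne' : (S.erase i₀).Nonempty :=
      Finset.card_pos.mp (by rw [Finset.card_erase_of_mem hi₀]; omega)
    obtain ⟨m, hm⟩ := hne'
    have : Nonempty {m : ι // m ∈ S.erase i₀} := ⟨⟨m, hm⟩⟩
    exact le_ciInf fun m => hmin m.1 (Finset.mem_of_mem_erase m.2)
  have hrest : (M - b * f i₀) * ∑ m ∈ S.erase i₀, y m ≤
      ∑ i ∈ S.erase i₀, y i * (f i - b * ⨅ m : {m : ι // m ∈ S.erase i}, f m.1) := by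
    rw [Finset.mul_sum]
    refine Finset.sum_le_sum fun i hi => ?_
    rw [mul_comm]
    refine mul_le_mul_of_nonneg_left ?_ (hy i (Finset.mem_of_mem_erase hi))
    have h1 := hle i₀ i hi
    have h2 := hle i i₀ (Finset.mem_erase.mpr ⟨(Finset.ne_of_mem_erase hi).symm, hi₀⟩)
    have h3 := mul_le_mul_of_nonneg_left h2 hb0
    linarith
  have hf₀ := hf i₀
  have hcoef : 0 ≤ M - b * f i₀ := by nlinarith
  have h4 := mul_le_mul_of_nonneg_left (hyS i₀ hi₀) hcoef
  have h5 : 0 ≤ y i₀ * ((1 - b) * (f i₀ + M)) :=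
    mul_nonneg (hy i₀ hi₀) (mul_nonneg (by linarith) (by linarith))
  nlinarith

theorem prod_bool_sign_eq_one_iff_even {ι : Type*} (S : Finset ι) (w : ι → Bool) :
    ∏ i ∈ S, (if w i then (-1 : ℝ) else 1) = 1 ↔
      Even ((S.filter (fun i => w i = true)).card) := by
  rw [Finset.prod_ite, Finset.prod_const, Finset.prod_const_one, mul_one]
  exact neg_one_pow_eq_one_iff_even (by norm_num)

/-- Two binary vectors of even weight on `S` cannot differ in exactly one position of `S`. -/
theorem exists_ne_of_even_of_ne {ι : Type*} [DecidableEq ι] {S : Finset ι} {w x : ι → Bool}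
    (hw : Even ((S.filter (fun i => w i = true)).card))
    (hx : Even ((S.filter (fun i => x i = true)).card))
    {i : ι} (hi : i ∈ S) (h : w i ≠ x i) : ∃ m ∈ S.erase i, w m ≠ x m := by
  by_contra! hall
  rw [← prod_bool_sign_eq_one_iff_even, ← Finset.mul_prod_erase S _ hi] at hw hx
  rw [Finset.prod_congr rfl fun m hm => by rw [hall m hm]] at hw
  revert hw hx h
  cases w i <;> cases x i <;> simp <;> intro hw hx <;> linarith

/-- The distance of `z` to a binary value. -/
def flipDist (x : Bool) (z : ℝ) : ℝ := if x then 1 - z else z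

theorem flipDist_nonneg {x : Bool} {z : ℝ} (h0 : 0 ≤ z) (h1 : z ≤ 1) : 0 ≤ flipDist x z := by
  unfold flipDist; split_ifs <;> linarith

/-- The cut inequalities of the fundamental polytope around a locally even binary vector. -/
theorem InPolytope.flipDist_le_sum {VL VR : Type*} [Fintype VL] [DecidableEq VL]
    {Nc : VR → Finset VL} {z : VL → ℝ} (hz : InPolytope Nc z) {x : VL → Bool} {j : VR}
    (hx : Even (((Nc j).filter (fun i => x i = true)).card)) {i : VL} (hi : i ∈ Nc j) :
    flipDist (x i) (z i) ≤ ∑ m ∈ (Nc j).erase i, flipDist (x m) (z m) := by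
  obtain ⟨α, hα0, hαe, hα1, hαz⟩ := hz.2 j
  have key : ∀ m ∈ Nc j, flipDist (x m) (z m) =
      ∑ w : VL → Bool, α w * flipDist (x m) (if w m then (1 : ℝ) else 0) := by
    intro m hm
    rw [hαz m hm]
    unfold flipDist
    split_ifs
    · simp only [mul_sub, mul_one, Finset.sum_sub_distrib, hα1]
    · rfl
  have hnn : ∀ (w : VL → Bool) m, 0 ≤ flipDist (x m) (if w m then (1 : ℝ) else 0) :=
    fun w m => flipDist_nonneg (by split_ifs <;> norm_num) (by split_ifs <;> norm_num)
  rw [key i hi, Finset.sum_congr rfl fun m hm => key m (Finset.mem_of_mem_erase hm),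
    Finset.sum_comm]
  refine Finset.sum_le_sum fun w _ => ?_
  rw [← Finset.mul_sum]
  rcases eq_or_ne (α w) 0 with h | h
  · simp [h]
  refine mul_le_mul_of_nonneg_left ?_ (hα0 w)
  by_cases hwx : w i = x i
  · refine le_trans (le_of_eq ?_) (Finset.sum_nonneg fun m _ => hnn w m)
    rw [hwx]; unfold flipDist; cases x i <;> simp
  · obtain ⟨m, hm, hne⟩ := exists_ne_of_even_of_ne (hαe w h) hx hi hwx
    refine le_trans ?_ (Finset.single_le_sum (fun m _ => hnn w m) hm)
    revert hwx hne
    unfold flipDist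
    cases w i <;> cases x i <;> cases w m <;> cases x m <;> simp

/-- Every codeword lies in the fundamental polytope. -/
theorem IsCodewordR.inPolytope {VL VR : Type*} [Fintype VL] [DecidableEq VL]
    {Nc : VR → Finset VL} {x : VL → ℝ} (hx : IsCodewordR Nc x) : InPolytope Nc x := by
  classical
  refine ⟨fun i => by rcases hx.1 i with h | h <;> rw [h] <;> norm_num, fun j => ?_⟩
  set w₀ : VL → Bool := fun i => decide (x i = 1) with hw₀
  have hxw : ∀ i, x i = if w₀ i then (1 : ℝ) else 0 := by
    intro i
    rcases hx.1 i with h | h <;> simp [hw₀, h]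
  refine ⟨fun w => if w = w₀ then 1 else 0, fun w => by dsimp only; split_ifs <;> norm_num, ?_, by simp, ?_⟩
  · intro w hw
    have hww : w = w₀ := by by_contra h; simp [h] at hw
    rw [hww]
    obtain ⟨m, hm⟩ := hx.2 j
    rw [Finset.sum_congr rfl fun i _ => hxw i, Finset.sum_boole] at hm
    have hm' : ((((Nc j).filter (fun i => w₀ i = true)).card : ℕ) : ℤ) = 2 * m := by
      exact_mod_cast hm
    rw [← Int.even_coe_nat, hm']
    exact even_two_mul m
  · intro i _
    simp only [ite_mul, one_mul, zero_mul, Finset.sum_ite_eq', Finset.mem_univ, if_true]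
    exact hxw i

/-- For a WMS-consistent fixed point with `β(d_v−1) < 1`, the hard decision
vector is a codeword, is LP-optimal over the fundamental polytope, and in particular is a
maximum-likelihood codeword. -/
theorem wms_consistent_fixed_point_is_LP_and_ML
    {VL VR : Type*} [Fintype VL] [Fintype VR] [DecidableEq VL] [DecidableEq VR]
    [Nonempty VL] [Nonempty VR]
    (Nv : VL → Finset VR) (Nc : VR → Finset VL) (dv dc : ℕ)
    (hsym : ∀ (i : VL) (j : VR), j ∈ Nv i ↔ i ∈ Nc j)
    (hdv : ∀ i : VL, (Nv i).card = dv) (hdc : ∀ j : VR, (Nc j).card = dc)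
    (hdv2 : 2 ≤ dv) (hdc2 : 2 ≤ dc)
    (γ : VL → ℝ) (β : ℝ) (hβ0 : 0 ≤ β) (hβ1 : β * ((dv : ℝ) - 1) < 1)
    (μs : VL → VR → ℝ)
    (hfix : ∀ i : VL, ∀ j ∈ Nv i, μs i j = Wop Nv Nc γ β μs i j)
    (hcons : WMSConsistent Nv Nc γ β μs) :
    IsCodewordR Nc (hardDec Nv Nc γ β μs) ∧
    (∀ z : VL → ℝ, InPolytope Nc z →
      ∑ i : VL, γ i * hardDec Nv Nc γ β μs i ≤ ∑ i : VL, γ i * z i) ∧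
    (∀ x : VL → ℝ, IsCodewordR Nc x →
      ∑ i : VL, γ i * hardDec Nv Nc γ β μs i ≤ ∑ i : VL, γ i * x i) := by
  obtain ⟨hne, -, hc2b, hdec⟩ := hcons
  set t : VL → ℝ := fun i => γ i + β * ∑ j ∈ Nv i, c2b Nc μs i j
  have hNv : ∀ i, (Nv i).Nonempty := fun i => Finset.card_pos.mp (by rw [hdv]; omega)
  have ht0 : ∀ i, t i ≠ 0 := by
    intro i h
    obtain ⟨j, hj⟩ := hNv i
    have h1 := hdec i j hj
    have h2 : Real.sign (t i) = 0 := by rw [h, Real.sign_zero]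
    exact hne i j hj (Real.sign_eq_zero_iff.mp (h1.symm.trans h2))
  set X : VL → Bool := fun i => decide (t i < 0) with hX
  have hsign : ∀ i, Real.sign (t i) = if X i then (-1 : ℝ) else 1 := by
    intro i
    rcases lt_or_gt_of_ne (ht0 i) with h | h
    · simp [hX, h, Real.sign_of_neg h]
    · simp [hX, not_lt.mpr h.le, Real.sign_of_pos h]
  have hsμ : ∀ i, ∀ j ∈ Nv i, Real.sign (μs i j) = if X i then (-1 : ℝ) else 1 :=
    fun i j hj => (hdec i j hj).symm.trans (hsign i)
  have hhard : ∀ i, hardDec Nv Nc γ β μs i = if X i then (1 : ℝ) else 0 := by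
    intro i
    change (1 - Real.sign (t i)) / 2 = _
    rw [hsign]
    split_ifs <;> norm_num
  have hprod : ∀ i j, c2b Nc μs i j =
      (∏ m ∈ (Nc j).erase i, if X m then (-1 : ℝ) else 1) *
        ⨅ m : {m : VL // m ∈ (Nc j).erase i}, |μs m.1 j| := by
    intro i j
    unfold c2b
    congr 1
    exact Finset.prod_congr rfl fun m hm =>
      hsμ m j ((hsym m j).mpr (Finset.mem_of_mem_erase hm))
  have hsq : ∀ i, (if X i then (-1 : ℝ) else 1) * (if X i then (-1 : ℝ) else 1) = 1 := by
    intro i; split_ifs <;> norm_num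
  have hext : ∀ i, ∀ j ∈ Nv i,
      (∏ m ∈ (Nc j).erase i, if X m then (-1 : ℝ) else 1) = if X i then (-1 : ℝ) else 1 := by
    intro i j hj
    have h1 := hc2b i j hj
    rw [hsμ i j hj, hprod i j] at h1
    have hnn : 0 ≤ ⨅ m : {m : VL // m ∈ (Nc j).erase i}, |μs m.1 j| :=
      Real.iInf_nonneg fun m => abs_nonneg _
    have hpos : 0 < ⨅ m : {m : VL // m ∈ (Nc j).erase i}, |μs m.1 j| := by
      refine lt_of_le_of_ne hnn fun h => ?_
      rw [← h, mul_zero, Real.sign_zero] at h1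
      have h2 := hsq i
      rw [← h1] at h2
      norm_num at h2
    have hpm : (∏ m ∈ (Nc j).erase i, if X m then (-1 : ℝ) else 1) = 1 ∨
        (∏ m ∈ (Nc j).erase i, if X m then (-1 : ℝ) else 1) = -1 := by
      refine Finset.prod_induction _ (fun r : ℝ => r = 1 ∨ r = -1) ?_ (Or.inl rfl) ?_
      · rintro a c (rfl | rfl) (rfl | rfl) <;> norm_num
      · intro m _
        split_ifs <;> simp
    rcases hpm with h | h
    · rw [h, one_mul, Real.sign_of_pos hpos] at h1
      exact h.trans h1
    · rw [h, neg_one_mul, Real.sign_of_neg (by linarith)] at h1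
      exact h.trans h1
  have heven : ∀ j, Even (((Nc j).filter (fun i => X i = true)).card) := by
    intro j
    obtain ⟨i, hi⟩ : (Nc j).Nonempty := Finset.card_pos.mp (by rw [hdc]; omega)
    rw [← prod_bool_sign_eq_one_iff_even, ← Finset.mul_prod_erase _ _ hi,
      hext i j ((hsym i j).mpr hi), hsq]
  set b : ℝ := β * ((dv : ℝ) - 1) with hb
  have hdv2' : (2 : ℝ) ≤ dv := by exact_mod_cast hdv2
  have hb0 : 0 ≤ b := mul_nonneg hβ0 (by linarith)
  have hγ : ∀ i, (dv : ℝ) * ((if X i then (-1 : ℝ) else 1) * γ i) =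
      ∑ j ∈ Nv i, (|μs i j| - b * ⨅ m : {m : VL // m ∈ (Nc j).erase i}, |μs m.1 j|) := by
    intro i
    have h1 : ∑ j ∈ Nv i, μs i j =
        dv * γ i + b * ∑ j ∈ Nv i, c2b Nc μs i j := by
      have h2 : ∀ j ∈ Nv i, μs i j =
          (γ i + β * ∑ k ∈ Nv i, c2b Nc μs i k) - β * c2b Nc μs i j := by
        intro j hj
        rw [hfix i j hj, Wop, ← Finset.add_sum_erase (Nv i) _ hj]
        ring
      rw [Finset.sum_congr rfl h2, Finset.sum_sub_distrib, Finset.sum_const, hdv,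
        ← Finset.mul_sum, nsmul_eq_mul, hb]
      ring
    have habs : ∀ j ∈ Nv i, |μs i j| = (if X i then (-1 : ℝ) else 1) * μs i j := by
      intro j hj
      have h3 := hsμ i j hj
      rw [← h3]
      rcases lt_or_gt_of_ne (hne i j hj) with h | h
      · rw [Real.sign_of_neg h, abs_of_neg h]; ring
      · rw [Real.sign_of_pos h, abs_of_pos h]; ring
    have hinf : ∀ j ∈ Nv i, (⨅ m : {m : VL // m ∈ (Nc j).erase i}, |μs m.1 j|) =
        (if X i then (-1 : ℝ) else 1) * c2b Nc μs i j := by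
      intro j hj
      rw [hprod i j, hext i j hj, ← mul_assoc, hsq, one_mul]
    rw [Finset.sum_congr rfl fun j hj => by rw [habs j hj, hinf j hj],
      Finset.sum_sub_distrib, ← Finset.mul_sum, ← Finset.mul_sum, ← Finset.mul_sum, h1]
    ring
  have hLP : ∀ z : VL → ℝ, InPolytope Nc z →
      ∑ i : VL, γ i * hardDec Nv Nc γ β μs i ≤ ∑ i : VL, γ i * z i := by
    intro z hz
    have hdiff : ∀ i, γ i * z i - γ i * hardDec Nv Nc γ β μs i =
        flipDist (X i) (z i) * ((if X i then (-1 : ℝ) else 1) * γ i) := by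
      intro i
      rw [hhard]
      unfold flipDist
      split_ifs <;> ring
    have hnonneg : 0 ≤ (dv : ℝ) *
        (∑ i : VL, γ i * z i - ∑ i : VL, γ i * hardDec Nv Nc γ β μs i) := by
      rw [← Finset.sum_sub_distrib, Finset.mul_sum]
      have h1 : ∀ i ∈ (Finset.univ : Finset VL),
          (dv : ℝ) * (γ i * z i - γ i * hardDec Nv Nc γ β μs i) =
          ∑ j ∈ Nv i, flipDist (X i) (z i) *
            (|μs i j| - b * ⨅ m : {m : VL // m ∈ (Nc j).erase i}, |μs m.1 j|) := by
        intro i _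
        rw [hdiff, ← Finset.mul_sum, ← hγ]
        ring
      rw [Finset.sum_congr rfl h1, Finset.sum_comm' (t' := Finset.univ) (s' := Nc)
        (fun i j => by simp [hsym])]
      exact Finset.sum_nonneg fun j _ =>
        sum_mul_sub_iInf_erase_nonneg (Nc j) (by rw [hdc]; exact hdc2) (fun m => |μs m j|)
          (fun i => flipDist (X i) (z i)) b hb0 hβ1 (fun _ => abs_nonneg _)
          (fun i _ => flipDist_nonneg (hz.1 i).1 (hz.1 i).2)
          (fun i hi => hz.flipDist_le_sum (heven j) hi)
    have h2 := nonneg_of_mul_nonneg_right hnonneg (by linarith)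
    linarith
  refine ⟨⟨fun i => ?_, fun j => ?_⟩, hLP, fun x hx => hLP x hx.inPolytope⟩
  · rw [hhard]
    split_ifs <;> simp
  · obtain ⟨n, hn⟩ := heven j
    refine ⟨n, ?_⟩
    rw [Finset.sum_congr rfl fun i _ => hhard i, Finset.sum_boole, hn]
    push_cast
    ring
end

section
/- Let δ ∈ (0,1) and let {μ_δ^{(ℓ)}} be the WMS iterates with parameter β = δ/(d_v−1). Suppose there are integers 0 < L_0 < L_1 such that {μ_δ^{(ℓ)}} satisfies BMP([L_0,L_1]). Then for every ℓ' ∈ {0,1,...,L_1−L_0}: sgn(μ_δ^{(ℓ'+L_1)}_{i→j}) = sgn(μ_δ^{(ℓ'+L_0)}_{i→j}) for all edges (i,j) ∈ E, and |μ_δ^{(ℓ'+L_1)}_{i→j}| ≥ |μ_δ^{(ℓ'+L_0)}_{i→j}| for all edges (i,j) ∈ E. -/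
open Finset Filter

/-- The block-wise monotone property BMP([L0, L1]) of a sequence of WMS message vectors
(for WMS-consistency with parameter `β`, and lower bound `‖γ‖_∞/δ`). -/
def BMP {VL VR : Type*} [DecidableEq VL] [DecidableEq VR]
    (Nv : VL → Finset VR) (Nc : VR → Finset VL) (γ : VL → ℝ) (β δ : ℝ)
    (μd : ℕ → VL → VR → ℝ) (L0 L1 : ℕ) : Prop :=
  (∀ ℓ : ℕ, L0 ≤ ℓ → ℓ ≤ L1 →
    WMSConsistent Nv Nc γ β (μd ℓ) ∧
    (∀ i : VL, ∀ j ∈ Nv i, Real.sign (μd ℓ i j) = Real.sign (μd L0 i j)) ∧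
    (∀ i : VL, ∀ j ∈ Nv i, gammaSup γ / δ ≤ |μd ℓ i j|)) ∧
  (∀ i : VL, ∀ j ∈ Nv i, |μd L0 i j| ≤ |μd L1 i j|)

/-- Multiplying `p` by the sign of `p * x` with `x ≥ 0` gives a nonnegative number. -/
lemma sign_mul_mul_nonneg {p x : ℝ} (hx : 0 ≤ x) : 0 ≤ Real.sign (p * x) * p := by
  rcases lt_trichotomy (p * x) 0 with h | h | h
  · have hp : p < 0 := by
      by_contra! hp
      exact absurd (mul_nonneg hp hx) (not_le.mpr h)
    rw [Real.sign_of_neg h]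
    linarith
  · simp [h]
  · have hp : 0 < p := pos_of_mul_pos_left h hx
    rw [Real.sign_of_pos h]
    linarith

/-- If `x` is dominated by `y` in the direction of the sign of `x ≠ 0`, then `y` has the same sign
as `x` and at least its absolute value. -/
lemma sign_eq_and_abs_le_of_sign_mul_le {x y : ℝ} (hx : x ≠ 0)
    (h : Real.sign x * x ≤ Real.sign x * y) : Real.sign y = Real.sign x ∧ |x| ≤ |y| := by
  rcases lt_or_gt_of_ne hx with hx | hx
  · rw [Real.sign_of_neg hx] at h ⊢
    have hy : y < 0 := by linarith
    rw [Real.sign_of_neg hy, abs_of_neg hx, abs_of_neg hy]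
    exact ⟨rfl, by linarith⟩
  · rw [Real.sign_of_pos hx] at h ⊢
    have hy : 0 < y := by linarith
    rw [Real.sign_of_pos hy, abs_of_pos hx, abs_of_pos hy]
    exact ⟨rfl, by linarith⟩

/-- Check-to-bit messages are monotone in the absolute values of messages with fixed signs. -/
lemma sign_mul_c2b_le {VL VR : Type*} [DecidableEq VL] (Nc : VR → Finset VL)
    {a b : VL → VR → ℝ} {i : VL} {k : VR}
    (hsign : ∀ m ∈ Nc k, Real.sign (b m k) = Real.sign (a m k))
    (habs : ∀ m ∈ Nc k, |a m k| ≤ |b m k|) :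
    Real.sign (c2b Nc a i k) * c2b Nc a i k ≤ Real.sign (c2b Nc a i k) * c2b Nc b i k := by
  have hprod : ∏ m ∈ (Nc k).erase i, Real.sign (b m k) =
      ∏ m ∈ (Nc k).erase i, Real.sign (a m k) :=
    Finset.prod_congr rfl fun m hm => hsign m (Finset.mem_of_mem_erase hm)
  have hmin : ⨅ m : {m : VL // m ∈ (Nc k).erase i}, |a m.1 k| ≤
      ⨅ m : {m : VL // m ∈ (Nc k).erase i}, |b m.1 k| :=
    Finite.ciInf_mono fun m => habs m.1 (Finset.mem_of_mem_erase m.2)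
  unfold c2b
  rw [hprod, ← mul_assoc, ← mul_assoc]
  exact mul_le_mul_of_nonneg_left hmin
    (sign_mul_mul_nonneg (Real.iInf_nonneg fun m => abs_nonneg _))

/-- The WMS operator preserves sign-wise domination of a consistent message vector. -/
lemma sign_mul_Wop_le {VL VR : Type*} [DecidableEq VL] [DecidableEq VR]
    {Nv : VL → Finset VR} {Nc : VR → Finset VL}
    (hsym : ∀ (i : VL) (j : VR), j ∈ Nv i ↔ i ∈ Nc j) {γ : VL → ℝ} {β : ℝ} (hβ : 0 ≤ β)
    {a b : VL → VR → ℝ} (ha : WMSConsistent Nv Nc γ β a)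
    (hsign : ∀ i : VL, ∀ j ∈ Nv i, Real.sign (b i j) = Real.sign (a i j))
    (habs : ∀ i : VL, ∀ j ∈ Nv i, |a i j| ≤ |b i j|) {i : VL} {j : VR} (hj : j ∈ Nv i) :
    Real.sign (a i j) * Wop Nv Nc γ β a i j ≤ Real.sign (a i j) * Wop Nv Nc γ β b i j := by
  obtain ⟨-, hvar, hc2b, -⟩ := ha
  have hsum : Real.sign (a i j) * ∑ k ∈ (Nv i).erase j, c2b Nc a i k ≤
      Real.sign (a i j) * ∑ k ∈ (Nv i).erase j, c2b Nc b i k := by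
    rw [Finset.mul_sum, Finset.mul_sum]
    refine Finset.sum_le_sum fun k hk => ?_
    have hk' := Finset.mem_of_mem_erase hk
    rw [hvar i j hj k hk', ← hc2b i k hk']
    exact sign_mul_c2b_le Nc (fun m hm => hsign m k ((hsym m k).mpr hm))
      (fun m hm => habs m k ((hsym m k).mpr hm))
  have := mul_le_mul_of_nonneg_left hsum hβ
  unfold Wop
  linarith

/-- If the WMS iterates with parameter `δ/(d_v−1)` satisfy BMP([L0,L1]),
then for each `0 ≤ ℓ' ≤ L1−L0`, the messages at time `ℓ'+L1` have the same signs as, and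
absolute values at least as large as, those at time `ℓ'+L0`. -/
theorem wms_bmp_extend_one_block
    {VL VR : Type*} [Fintype VL] [Fintype VR] [DecidableEq VL] [DecidableEq VR]
    [Nonempty VL] [Nonempty VR]
    (Nv : VL → Finset VR) (Nc : VR → Finset VL) (dv dc : ℕ)
    (hsym : ∀ (i : VL) (j : VR), j ∈ Nv i ↔ i ∈ Nc j)
    (hdv : ∀ i : VL, (Nv i).card = dv) (hdc : ∀ j : VR, (Nc j).card = dc)
    (hdv2 : 2 ≤ dv) (hdc2 : 2 ≤ dc)
    (γ : VL → ℝ) (δ : ℝ) (hδ0 : 0 < δ) (hδ1 : δ < 1)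
    (μd : ℕ → VL → VR → ℝ)
    (hμd : μd = wmsIter Nv Nc γ (δ / ((dv : ℝ) - 1)))
    (L0 L1 : ℕ) (hL0 : 0 < L0) (hL : L0 < L1)
    (hbmp : BMP Nv Nc γ (δ / ((dv : ℝ) - 1)) δ μd L0 L1) :
    ∀ ℓ' : ℕ, ℓ' ≤ L1 - L0 →
      (∀ i : VL, ∀ j ∈ Nv i,
        Real.sign (μd (ℓ' + L1) i j) = Real.sign (μd (ℓ' + L0) i j)) ∧
      (∀ i : VL, ∀ j ∈ Nv i, |μd (ℓ' + L0) i j| ≤ |μd (ℓ' + L1) i j|) := by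
  obtain ⟨hblock, hends⟩ := hbmp
  have hβ : 0 ≤ δ / ((dv : ℝ) - 1) := by
    have : (2 : ℝ) ≤ dv := by exact_mod_cast hdv2
    exact div_nonneg hδ0.le (by linarith)
  have hstep : ∀ n, μd (n + 1) = Wop Nv Nc γ (δ / ((dv : ℝ) - 1)) (μd n) := fun n => by
    rw [hμd]
    exact Function.iterate_succ_apply' _ _ _
  intro ℓ'
  induction ℓ' with
  | zero =>
    intro _
    rw [zero_add, zero_add]
    exact ⟨(hblock L1 hL.le le_rfl).2.1, hends⟩
  | succ n ih =>
    intro hn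
    obtain ⟨hsign, habs⟩ := ih (by omega)
    obtain ⟨hcons, hsgn, -⟩ := hblock (n + L0) (by omega) (by omega)
    obtain ⟨hcons', hsgn', -⟩ := hblock (n + 1 + L0) (by omega) (by omega)
    have key : ∀ i : VL, ∀ j ∈ Nv i,
        Real.sign (μd (n + 1 + L1) i j) = Real.sign (μd (n + 1 + L0) i j) ∧
          |μd (n + 1 + L0) i j| ≤ |μd (n + 1 + L1) i j| := fun i j hj => by
      refine sign_eq_and_abs_le_of_sign_mul_le (hcons'.1 i j hj) ?_
      rw [hsgn' i j hj, ← hsgn i j hj, add_right_comm n 1 L0, add_right_comm n 1 L1,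
        hstep, hstep]
      exact sign_mul_Wop_le hsym hβ hcons hsign habs hj
    exact ⟨fun i j hj => (key i j hj).1, fun i j hj => (key i j hj).2⟩
end

section
/- Let δ ∈ (0,1) and let {μ_δ^{(ℓ)}} be the WMS iterates with parameter β = δ/(d_v−1). Suppose there are integers 0 < L_0 < L_1 such that {μ_δ^{(ℓ)}} satisfies BMP([L_0,L_1]). Then {μ_δ^{(ℓ)}} also satisfies BMP([L_1, 2L_1−L_0]). -/
open Finset Filter

theorem Real.sign_eq_sign_iff_sign_mul_pos {a x : ℝ} (ha : a ≠ 0) :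
    Real.sign x = Real.sign a ↔ 0 < Real.sign a * x := by
  rcases lt_or_gt_of_ne ha with h | h
  · rw [Real.sign_of_neg h]
    refine ⟨fun hx => ?_, fun hx => Real.sign_of_neg (by linarith)⟩
    rcases lt_trichotomy x 0 with h' | h' | h'
    · linarith
    · norm_num [h'] at hx
    · norm_num [Real.sign_of_pos h'] at hx
  · rw [Real.sign_of_pos h]
    refine ⟨fun hx => ?_, fun hx => Real.sign_of_pos (by linarith)⟩
    rcases lt_trichotomy x 0 with h' | h' | h'
    · norm_num [Real.sign_of_neg h'] at hx
    · norm_num [h'] at hx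
    · linarith

theorem Real.sign_mul_eq_abs (x : ℝ) : Real.sign x * x = |x| := by
  rcases lt_trichotomy x 0 with h | h | h
  · rw [Real.sign_of_neg h, abs_of_neg h]; ring
  · simp [h]
  · rw [Real.sign_of_pos h, abs_of_pos h]; ring

/-- Check-to-bit messages in a given direction can only grow when the incoming magnitudes grow
and the incoming signs are unchanged. -/
theorem mul_c2b_le_mul_c2b {VL VR : Type*} [DecidableEq VL] (Nc : VR → Finset VL)
    (μ ν : VL → VR → ℝ) (i : VL) (k : VR) (s : ℝ)
    (hsign : ∀ m ∈ Nc k, Real.sign (ν m k) = Real.sign (μ m k))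
    (habs : ∀ m ∈ Nc k, |μ m k| ≤ |ν m k|) (hpos : 0 < s * c2b Nc μ i k) :
    s * c2b Nc μ i k ≤ s * c2b Nc ν i k := by
  unfold c2b at *
  rw [← mul_assoc] at *
  rw [Finset.prod_congr rfl fun m hm => hsign m (Finset.mem_of_mem_erase hm), ← mul_assoc]
  refine mul_le_mul_of_nonneg_left (ciInf_mono ⟨0, ?_⟩ fun m =>
    habs m.1 (Finset.mem_of_mem_erase m.2)) ?_
  · rintro _ ⟨m, rfl⟩
    exact abs_nonneg _
  · exact (pos_of_mul_pos_left hpos (Real.iInf_nonneg fun _ => abs_nonneg _)).le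

/-- If the WMS iterates with parameter `δ/(d_v−1)` satisfy BMP([L0,L1]),
then they also satisfy BMP([L1, 2L1−L0]). -/
theorem wms_bmp_next_block
    {VL VR : Type*} [Fintype VL] [Fintype VR] [DecidableEq VL] [DecidableEq VR]
    [Nonempty VL] [Nonempty VR]
    (Nv : VL → Finset VR) (Nc : VR → Finset VL) (dv dc : ℕ)
    (hsym : ∀ (i : VL) (j : VR), j ∈ Nv i ↔ i ∈ Nc j)
    (hdv : ∀ i : VL, (Nv i).card = dv) (hdc : ∀ j : VR, (Nc j).card = dc)
    (hdv2 : 2 ≤ dv) (hdc2 : 2 ≤ dc)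
    (γ : VL → ℝ) (δ : ℝ) (hδ0 : 0 < δ) (hδ1 : δ < 1)
    (μd : ℕ → VL → VR → ℝ)
    (hμd : μd = wmsIter Nv Nc γ (δ / ((dv : ℝ) - 1)))
    (L0 L1 : ℕ) (hL0 : 0 < L0) (hL : L0 < L1)
    (hbmp : BMP Nv Nc γ (δ / ((dv : ℝ) - 1)) δ μd L0 L1) :
    BMP Nv Nc γ (δ / ((dv : ℝ) - 1)) δ μd L1 (2 * L1 - L0) := by
  subst hμd
  set β : ℝ := δ / ((dv : ℝ) - 1) with hβdef
  set μ := wmsIter Nv Nc γ β with hμ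
  have hβ : 0 ≤ β := by
    have : (2 : ℝ) ≤ dv := by exact_mod_cast hdv2
    exact div_nonneg hδ0.le (by linarith)
  have hstep : ∀ n i j, μ (n + 1) i j = γ i + β * ∑ k ∈ (Nv i).erase j, c2b Nc (μ n) i k := by
    intro n i j
    simp only [hμ, wmsIter, Function.iterate_succ_apply', Wop]
  obtain ⟨hblock, hend⟩ := hbmp
  have h0 : ∀ i, ∀ j ∈ Nv i, μ L0 i j ≠ 0 := (hblock L0 le_rfl hL.le).1.1
  have h0s : ∀ i, ∀ j ∈ Nv i, ∀ j' ∈ Nv i, Real.sign (μ L0 i j) = Real.sign (μ L0 i j') :=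
    (hblock L0 le_rfl hL.le).1.2.1
  -- Growth of the check-to-bit messages from one block to the next.
  have hc2b : ∀ t, L0 + t ≤ L1 →
      (∀ i, ∀ j ∈ Nv i, Real.sign (μ (L1 + t) i j) = Real.sign (μ L0 i j) ∧
        |μ (L0 + t) i j| ≤ |μ (L1 + t) i j|) →
      ∀ i, ∀ j ∈ Nv i, ∀ k ∈ Nv i, 0 < Real.sign (μ L0 i j) * c2b Nc (μ (L0 + t)) i k ∧
        Real.sign (μ L0 i j) * c2b Nc (μ (L0 + t)) i k ≤
          Real.sign (μ L0 i j) * c2b Nc (μ (L1 + t)) i k := by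
    intro t ht ih i j hj k hk
    obtain ⟨hcons, hsgn, -⟩ := hblock (L0 + t) (by omega) ht
    have hpos : 0 < Real.sign (μ L0 i j) * c2b Nc (μ (L0 + t)) i k := by
      rw [← Real.sign_eq_sign_iff_sign_mul_pos (h0 i j hj), hcons.2.2.1 i k hk, hsgn i k hk]
      exact h0s i k hk j hj
    refine ⟨hpos, mul_c2b_le_mul_c2b Nc _ _ i k _ (fun m hm => ?_) (fun m hm => ?_) hpos⟩
    · have hm' := (hsym m k).2 hm
      rw [(ih m k hm').1, hsgn m k hm']
    · exact (ih m k ((hsym m k).2 hm)).2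
  have key : ∀ t, L0 + t ≤ L1 → ∀ i, ∀ j ∈ Nv i,
      Real.sign (μ (L1 + t) i j) = Real.sign (μ L0 i j) ∧
        |μ (L0 + t) i j| ≤ |μ (L1 + t) i j| := by
    intro t
    induction t with
    | zero => exact fun _ i j hj => ⟨(hblock L1 hL.le le_rfl).2.1 i j hj, hend i j hj⟩
    | succ t ih =>
      intro ht i j hj
      have hc := hc2b t (by omega) (ih (by omega)) i j hj
      obtain ⟨hcons, hsgn, -⟩ := hblock (L0 + (t + 1)) (by omega) ht
      have hs := hsgn i j hj
      have hne := hcons.1 i j hj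
      have hle : Real.sign (μ L0 i j) * μ (L0 + (t + 1)) i j ≤
          Real.sign (μ L0 i j) * μ (L1 + (t + 1)) i j := by
        rw [← add_assoc, ← add_assoc, hstep, hstep, mul_add, mul_add, mul_left_comm,
          mul_left_comm _ β,
        Finset.mul_sum _ _ (Real.sign _), Finset.mul_sum _ _ (Real.sign _)]
        exact add_le_add_right (mul_le_mul_of_nonneg_left
          (Finset.sum_le_sum fun k hk => (hc k (Finset.mem_of_mem_erase hk)).2) hβ) _
      have habs : Real.sign (μ L0 i j) * μ (L0 + (t + 1)) i j = |μ (L0 + (t + 1)) i j| := by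
        rw [← hs, Real.sign_mul_eq_abs]
      have hs' : Real.sign (μ (L1 + (t + 1)) i j) = Real.sign (μ L0 i j) := by
        rw [Real.sign_eq_sign_iff_sign_mul_pos (h0 i j hj)]
        have := abs_pos.2 hne
        linarith
      refine ⟨hs', ?_⟩
      rw [← Real.sign_mul_eq_abs (μ (L1 + (t + 1)) i j), hs']
      linarith
  refine ⟨fun ℓ h1 h2 => ?_, fun i j hj => ?_⟩
  · obtain ⟨t, rfl⟩ := Nat.exists_eq_add_of_le h1
    have ht : L0 + t ≤ L1 := by omega
    have hk := key t ht
    obtain ⟨hcons, hsgn, hlow⟩ := hblock (L0 + t) (by omega) ht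
    refine ⟨⟨fun i j hj => ?_, fun i j hj j' hj' => ?_, fun i j hj => ?_, fun i j hj => ?_⟩,
      fun i j hj => ?_, fun i j hj => (hlow i j hj).trans (hk i j hj).2⟩
    · exact abs_pos.1 ((abs_pos.2 (hcons.1 i j hj)).trans_le (hk i j hj).2)
    · rw [(hk i j hj).1, (hk i j' hj').1, h0s i j hj j' hj']
    · rw [(hk i j hj).1, Real.sign_eq_sign_iff_sign_mul_pos (h0 i j hj)]
      have := hc2b t ht hk i j hj j hj
      exact this.1.trans_le this.2
    · have hold := hcons.2.2.2 i j hj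
      rw [hsgn i j hj, Real.sign_eq_sign_iff_sign_mul_pos (h0 i j hj)] at hold
      rw [(hk i j hj).1, Real.sign_eq_sign_iff_sign_mul_pos (h0 i j hj)]
      refine hold.trans_le ?_
      rw [mul_add, mul_add, mul_left_comm, mul_left_comm _ β,
        Finset.mul_sum _ _ (Real.sign _), Finset.mul_sum _ _ (Real.sign _)]
      exact add_le_add_right (mul_le_mul_of_nonneg_left
        (Finset.sum_le_sum fun k hkm => (hc2b t ht hk i j hj k hkm).2) hβ) _
    · rw [(hk i j hj).1, (hblock L1 hL.le le_rfl).2.1 i j hj]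
  · have := (key (L1 - L0) (by omega) i j hj).2
    rwa [show L0 + (L1 - L0) = L1 by omega, show L1 + (L1 - L0) = 2 * L1 - L0 by omega] at this
end

section
/- Let {μ^{(ℓ)}} be the WMS iterates with parameter β = 1/(d_v−1) and suppose {μ^{(ℓ)}} is divergent and consistent. Then there exist an integer L_0 > 0 and δ ∈ (0,1) such that the WMS iterates {μ_δ^{(ℓ)}} with parameter β = δ/(d_v−1) satisfy, for every ℓ ≥ L_0: |μ_δ^{(ℓ)}_{i→j}| ≥ ‖γ‖_∞/δ for all edges (i,j) ∈ E, and sgn(μ_δ^{(ℓ)}_{i→j}) = sgn(μ^{(L_0)}_{i→j}) for all edges (i,j) ∈ E. -/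
open Finset Filter

/-- The WMS iterates with parameter `1/(d_v−1)` are divergent and consistent: every edge
message tends to `+∞` or `−∞`, and from some iteration on the messages are WMS-consistent. -/
def DivergentConsistent {VL VR : Type*} [DecidableEq VL] [DecidableEq VR]
    (Nv : VL → Finset VR) (Nc : VR → Finset VL) (γ : VL → ℝ) (dv : ℕ)
    (μseq : ℕ → VL → VR → ℝ) : Prop :=
  (∀ i : VL, ∀ j ∈ Nv i,
    Tendsto (fun ℓ => μseq ℓ i j) atTop atTop ∨
    Tendsto (fun ℓ => μseq ℓ i j) atTop atBot) ∧
  (∃ L : ℕ, 0 < L ∧ ∀ ℓ : ℕ, L ≤ ℓ → WMSConsistent Nv Nc γ (1 / ((dv : ℝ) - 1)) (μseq ℓ))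

theorem Real.sign_eq_of_mul_pos {s x : ℝ} (hs : s * s = 1) (h : 0 < s * x) :
    Real.sign x = s := by
  rcases mul_self_eq_one_iff.mp hs with rfl | rfl
  · exact Real.sign_of_pos (by linarith)
  · exact Real.sign_of_neg (by linarith)

theorem abs_eq_of_mul_pos {s x : ℝ} (hs : s * s = 1) (h : 0 < s * x) : |x| = s * x := by
  rcases mul_self_eq_one_iff.mp hs with rfl | rfl
  · rw [abs_of_pos (by linarith), one_mul]
  · rw [abs_of_neg (by linarith), neg_one_mul]

theorem continuousAt_finite_iInf {X ι : Type*} [TopologicalSpace X] [Finite ι] {f : X → ι → ℝ}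
    {a : X} (hf : ∀ i, ContinuousAt (fun x => f x i) a) :
    ContinuousAt (fun x => ⨅ i, f x i) a := by
  have := Fintype.ofFinite ι
  cases isEmpty_or_nonempty ι
  · simpa only [Real.iInf_of_isEmpty] using continuousAt_const
  · simp only [← Finset.inf'_univ_eq_ciInf]
    exact ContinuousAt.finset_inf'_apply _ fun i _ => hf i

theorem continuousAt_sign {x : ℝ} (hx : x ≠ 0) : ContinuousAt Real.sign x := by
  rcases lt_or_gt_of_ne hx with h | h
  · refine (continuousAt_const (y := (-1 : ℝ))).congr ?_
    filter_upwards [eventually_lt_nhds h] with y hy using (Real.sign_of_neg hy).symm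
  · refine (continuousAt_const (y := (1 : ℝ))).congr ?_
    filter_upwards [eventually_gt_nhds h] with y hy using (Real.sign_of_pos hy).symm

section MinSum

variable {VL VR : Type*} [DecidableEq VL]

theorem abs_c2b_le (Nc : VR → Finset VL) (μ : VL → VR → ℝ) {i m : VL} {k : VR}
    (hm : m ∈ (Nc k).erase i) : |c2b Nc μ i k| ≤ |μ m k| := by
  have hinf : (⨅ m : {m : VL // m ∈ (Nc k).erase i}, |μ m.1 k|) ≤ |μ m k| :=
    ciInf_le (f := fun m : {m : VL // m ∈ (Nc k).erase i} => |μ m.1 k|)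
      (Set.finite_range _).bddBelow ⟨m, hm⟩
  have hnonneg : 0 ≤ ⨅ m : {m : VL // m ∈ (Nc k).erase i}, |μ m.1 k| :=
    Real.iInf_nonneg fun _ => abs_nonneg _
  have hprod : |∏ m ∈ (Nc k).erase i, Real.sign (μ m k)| ≤ 1 := by
    rw [Finset.abs_prod]
    exact Finset.prod_le_one (fun _ _ => abs_nonneg _) fun _ _ => Real.abs_sign_le_one _
  rw [c2b, abs_mul, abs_of_nonneg hnonneg]
  exact (mul_le_of_le_one_left hnonneg hprod).trans hinf

theorem continuousAt_c2b {X : Type*} [TopologicalSpace X] (Nc : VR → Finset VL)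
    {μ : X → VL → VR → ℝ} {a : X} (hμ : ∀ i j, ContinuousAt (fun x => μ x i j) a)
    (i : VL) (k : VR) : ContinuousAt (fun x => c2b Nc (μ x) i k) a := by
  by_cases h : ∃ m ∈ (Nc k).erase i, μ a m k = 0
  · obtain ⟨m, hm, h0⟩ := h
    have hzero : c2b Nc (μ a) i k = 0 := by
      rw [c2b, Finset.prod_eq_zero hm (by simp [h0]), zero_mul]
    rw [ContinuousAt, hzero]
    have hlim := (hμ m k).abs
    rw [ContinuousAt, h0, abs_zero] at hlim
    exact squeeze_zero_norm (fun x => abs_c2b_le Nc (μ x) hm) hlim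
  · push Not at h
    refine ContinuousAt.mul ?_ (continuousAt_finite_iInf fun m => (hμ m.1 k).abs)
    exact tendsto_finsetProd _ fun m hm =>
      ContinuousAt.comp' (f := fun x => μ x m k) (continuousAt_sign (h m hm)) (hμ m k)

theorem sign_c2b_of_sign_pattern (Nc : VR → Finset VL) {μ : VL → VR → ℝ} {s : VL → ℝ}
    (hs : ∀ i, s i * s i = 1) {i : VL} {k : VR} (hne : ((Nc k).erase i).Nonempty)
    (hμ : ∀ m ∈ Nc k, 0 < s m * μ m k) :
    Real.sign (c2b Nc μ i k) = ∏ m ∈ (Nc k).erase i, s m := by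
  have : Nonempty {m : VL // m ∈ (Nc k).erase i} := hne.to_subtype
  have hpos : 0 < ⨅ m : {m : VL // m ∈ (Nc k).erase i}, |μ m.1 k| := by
    obtain ⟨m, hm⟩ := exists_eq_ciInf_of_finite
      (f := fun m : {m : VL // m ∈ (Nc k).erase i} => |μ m.1 k|)
    rw [← hm, abs_eq_of_mul_pos (hs m) (hμ m (Finset.mem_of_mem_erase m.2))]
    exact hμ m (Finset.mem_of_mem_erase m.2)
  have hsq : (∏ m ∈ (Nc k).erase i, s m) * ∏ m ∈ (Nc k).erase i, s m = 1 := by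
    rw [← Finset.prod_mul_distrib]
    exact Finset.prod_eq_one fun m _ => hs m
  have hsign : ∏ m ∈ (Nc k).erase i, Real.sign (μ m k) = ∏ m ∈ (Nc k).erase i, s m :=
    Finset.prod_congr rfl fun m hm =>
      Real.sign_eq_of_mul_pos (hs m) (hμ m (Finset.mem_of_mem_erase hm))
  refine Real.sign_eq_of_mul_pos hsq ?_
  rw [c2b, hsign, ← mul_assoc, hsq, one_mul]
  exact hpos

theorem sign_mul_c2b (Nc : VR → Finset VL) {μ : VL → VR → ℝ} {s : VL → ℝ}
    (hs : ∀ i, s i * s i = 1) {i : VL} {k : VR}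
    (hprod : ∏ m ∈ (Nc k).erase i, s m = s i) (hμ : ∀ m ∈ Nc k, 0 < s m * μ m k) :
    s i * c2b Nc μ i k = ⨅ m : {m : VL // m ∈ (Nc k).erase i}, s m * μ m.1 k := by
  have hsign : ∏ m ∈ (Nc k).erase i, Real.sign (μ m k) = s i := by
    rw [← hprod]
    exact Finset.prod_congr rfl fun m hm =>
      Real.sign_eq_of_mul_pos (hs m) (hμ m (Finset.mem_of_mem_erase hm))
  rw [c2b, hsign, ← mul_assoc, hs, one_mul]
  exact iInf_congr fun m =>
    abs_eq_of_mul_pos (hs m) (hμ m (Finset.mem_of_mem_erase m.2))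

variable [DecidableEq VR]

theorem wmsIter_succ (Nv : VL → Finset VR) (Nc : VR → Finset VL) (γ : VL → ℝ) (β : ℝ) (n : ℕ) :
    wmsIter Nv Nc γ β (n + 1) = Wop Nv Nc γ β (wmsIter Nv Nc γ β n) :=
  Function.iterate_succ_apply' _ _ _

theorem continuousAt_wmsIter {X : Type*} [TopologicalSpace X] (Nv : VL → Finset VR)
    (Nc : VR → Finset VL) (γ : VL → ℝ) {β : X → ℝ} {a : X} (hβ : ContinuousAt β a)
    (n : ℕ) (i : VL) (j : VR) : ContinuousAt (fun x => wmsIter Nv Nc γ (β x) n i j) a := by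
  induction n generalizing i j with
  | zero => exact continuousAt_const
  | succ n ih =>
    simp only [wmsIter_succ, Wop]
    exact continuousAt_const.add (hβ.mul
      (tendsto_finsetSum _ fun k _ => continuousAt_c2b Nc ih i k))

/-- On message vectors with a fixed sign pattern satisfying every check, the weighted min-sum
operator is monotone relative to that pattern. -/
theorem sign_mul_Wop_mono (Nv : VL → Finset VR) (Nc : VR → Finset VL) (γ : VL → ℝ) {β : ℝ}
    (hβ : 0 ≤ β) (hsym : ∀ (i : VL) (j : VR), j ∈ Nv i ↔ i ∈ Nc j) {s : VL → ℝ}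
    (hs : ∀ i, s i * s i = 1)
    (hprod : ∀ i, ∀ k ∈ Nv i, ∏ m ∈ (Nc k).erase i, s m = s i) {μ ν : VL → VR → ℝ}
    (hμ : ∀ i, ∀ j ∈ Nv i, 0 < s i * μ i j)
    (hμν : ∀ i, ∀ j ∈ Nv i, s i * μ i j ≤ s i * ν i j) (i : VL) (j : VR) :
    s i * Wop Nv Nc γ β μ i j ≤ s i * Wop Nv Nc γ β ν i j := by
  simp only [Wop, mul_add, mul_left_comm (s i) β, Finset.mul_sum]
  refine add_le_add le_rfl (Finset.sum_le_sum fun k hk => mul_le_mul_of_nonneg_left ?_ hβ)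
  have hk' := Finset.mem_of_mem_erase hk
  rw [sign_mul_c2b Nc hs (hprod i k hk') fun m hm => hμ m k ((hsym m k).mpr hm),
    sign_mul_c2b Nc hs (hprod i k hk') fun m hm =>
      (hμ m k ((hsym m k).mpr hm)).trans_le (hμν m k ((hsym m k).mpr hm))]
  exact ciInf_mono (Set.finite_range _).bddBelow fun m =>
    hμν m k ((hsym m k).mpr (Finset.mem_of_mem_erase m.2))

/-- If, relative to a sign pattern satisfying every check, the iterates are bounded below by
`c > 0` on a time window and do not decrease across it, they are bounded below by `c` forever. -/
theorem le_sign_mul_wmsIter (Nv : VL → Finset VR) (Nc : VR → Finset VL) (γ : VL → ℝ) {β : ℝ}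
    (hβ : 0 ≤ β) (hsym : ∀ (i : VL) (j : VR), j ∈ Nv i ↔ i ∈ Nc j) {s : VL → ℝ}
    (hs : ∀ i, s i * s i = 1)
    (hprod : ∀ i, ∀ k ∈ Nv i, ∏ m ∈ (Nc k).erase i, s m = s i) {c : ℝ} (hc : 0 < c)
    {L T : ℕ} (hT : 0 < T)
    (hwin : ∀ ℓ < T, ∀ i, ∀ j ∈ Nv i, c ≤ s i * wmsIter Nv Nc γ β (L + ℓ) i j)
    (hinc : ∀ i, ∀ j ∈ Nv i,
      s i * wmsIter Nv Nc γ β L i j ≤ s i * wmsIter Nv Nc γ β (L + T) i j)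
    {ℓ : ℕ} (hℓ : L ≤ ℓ) : ∀ i, ∀ j ∈ Nv i, c ≤ s i * wmsIter Nv Nc γ β ℓ i j := by
  have key : ∀ n, (∀ ℓ < n + T, ∀ i, ∀ j ∈ Nv i, c ≤ s i * wmsIter Nv Nc γ β (L + ℓ) i j) ∧
      ∀ i, ∀ j ∈ Nv i,
        s i * wmsIter Nv Nc γ β (L + n) i j ≤ s i * wmsIter Nv Nc γ β (L + n + T) i j := by
    intro n
    induction n with
    | zero => exact ⟨by simpa using hwin, hinc⟩
    | succ n ih =>
      obtain ⟨hlow, hmono⟩ := ih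
      refine ⟨fun ℓ hℓ i j hj => ?_, fun i j _ => ?_⟩
      · rcases Nat.lt_or_ge ℓ (n + T) with h | h
        · exact hlow ℓ h i j hj
        · obtain rfl : ℓ = n + T := by omega
          rw [← add_assoc]
          exact (hlow n (by omega) i j hj).trans (hmono i j hj)
      · rw [← add_assoc, add_right_comm (L + n) 1 T, wmsIter_succ, wmsIter_succ]
        exact sign_mul_Wop_mono Nv Nc γ hβ hsym hs hprod
          (fun i j hj => hc.trans_le (hlow n (by omega) i j hj)) hmono i j
  obtain ⟨n, rfl⟩ := Nat.exists_eq_add_of_le hℓ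
  exact (key n).1 n (by omega)

end MinSum

/-- If the WMS iterates with parameter `1/(d_v−1)` are divergent and
consistent, then there are `L0 > 0` and `δ ∈ (0,1)` such that the WMS iterates with
parameter `δ/(d_v−1)` are, from time `L0` on, bounded below by `‖γ‖_∞/δ` in absolute value
and match the signs of the original iterates at time `L0`. -/
theorem wms_divergent_consistent_delta_iterates
    {VL VR : Type*} [Fintype VL] [Fintype VR] [DecidableEq VL] [DecidableEq VR]
    [Nonempty VL] [Nonempty VR]
    (Nv : VL → Finset VR) (Nc : VR → Finset VL) (dv dc : ℕ)
    (hsym : ∀ (i : VL) (j : VR), j ∈ Nv i ↔ i ∈ Nc j)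
    (hdv : ∀ i : VL, (Nv i).card = dv) (hdc : ∀ j : VR, (Nc j).card = dc)
    (hdv2 : 2 ≤ dv) (hdc2 : 2 ≤ dc)
    (γ : VL → ℝ)
    (μ1 : ℕ → VL → VR → ℝ)
    (hμ1 : μ1 = wmsIter Nv Nc γ (1 / ((dv : ℝ) - 1)))
    (hdiv : DivergentConsistent Nv Nc γ dv μ1) :
    ∃ L0 : ℕ, 0 < L0 ∧ ∃ δ : ℝ, 0 < δ ∧ δ < 1 ∧
      ∀ ℓ : ℕ, L0 ≤ ℓ → ∀ i : VL, ∀ j ∈ Nv i,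
        gammaSup γ / δ ≤ |wmsIter Nv Nc γ (δ / ((dv : ℝ) - 1)) ℓ i j| ∧
        Real.sign (wmsIter Nv Nc γ (δ / ((dv : ℝ) - 1)) ℓ i j) =
          Real.sign (μ1 L0 i j) := by
  subst hμ1
  obtain ⟨hlim, L, hLpos, hcons⟩ := hdiv
  set β₀ : ℝ := 1 / ((dv : ℝ) - 1)
  set M := gammaSup γ
  have hMnonneg : 0 ≤ M := Real.iSup_nonneg fun _ => abs_nonneg _
  have hdvpos : (0 : ℝ) < (dv : ℝ) - 1 := by
    have : (2 : ℝ) ≤ dv := by exact_mod_cast hdv2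
    linarith
  have hsigns : ∀ i j, ∃ t : ℝ, t * t = 1 ∧
      (j ∈ Nv i → Tendsto (fun ℓ => t * wmsIter Nv Nc γ β₀ ℓ i j) atTop atTop) := by
    intro i j
    by_cases hj : j ∈ Nv i
    · rcases hlim i j hj with h | h
      · exact ⟨1, by norm_num, fun _ => by simpa using h⟩
      · exact ⟨-1, by norm_num, fun _ => by simpa using h⟩
    · exact ⟨1, by norm_num, fun h => absurd h hj⟩
  choose t ht htlim using hsigns
  have hlarge : ∀ᶠ ℓ in atTop, ∀ i j, j ∈ Nv i →
      M + 2 ≤ t i j * wmsIter Nv Nc γ β₀ ℓ i j := by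
    simp only [eventually_all]
    exact fun i j hj => (htlim i j hj).eventually_ge_atTop _
  obtain ⟨L1, hL1⟩ := eventually_atTop.mp hlarge
  set L0 := max L L1
  obtain ⟨-, hcons₂, hcons₃, -⟩ := hcons L0 (le_max_left _ _)
  have hsign_t : ∀ i, ∀ j ∈ Nv i, Real.sign (wmsIter Nv Nc γ β₀ L0 i j) = t i j :=
    fun i j hj => Real.sign_eq_of_mul_pos (ht i j)
      (by linarith [hL1 L0 (le_max_right _ _) i j hj])
  have hne : ∀ i, (Nv i).Nonempty := fun i => Finset.card_pos.mp (by rw [hdv i]; omega)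
  choose e he using hne
  let s : VL → ℝ := fun i => t i (e i)
  have hs : ∀ i, s i * s i = 1 := fun i => ht i (e i)
  have hts : ∀ i, ∀ j ∈ Nv i, t i j = s i := fun i j hj => by
    rw [← hsign_t i j hj, hcons₂ i j hj (e i) (he i), hsign_t i _ (he i)]
  have hlow : ∀ ℓ, L0 ≤ ℓ → ∀ i, ∀ j ∈ Nv i, M + 2 ≤ s i * wmsIter Nv Nc γ β₀ ℓ i j :=
    fun ℓ hℓ i j hj => by
      rw [← hts i j hj]
      exact hL1 ℓ ((le_max_right _ _).trans hℓ) i j hj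
  have hprod : ∀ i, ∀ k ∈ Nv i, ∏ m ∈ (Nc k).erase i, s m = s i := by
    intro i k hk
    have herase : ((Nc k).erase i).Nonempty := Finset.card_pos.mp (by
      rw [Finset.card_erase_of_mem ((hsym i k).mp hk), hdc]
      omega)
    rw [← sign_c2b_of_sign_pattern Nc hs herase (fun m hm => lt_of_lt_of_le (by linarith)
      (hlow L0 le_rfl m k ((hsym m k).mpr hm))), hcons₃ i k hk, hsign_t i k hk, hts i k hk]
  have hgrow : ∀ᶠ ℓ in atTop, ∀ i j, j ∈ Nv i →
      s i * wmsIter Nv Nc γ β₀ L0 i j + 1 ≤ s i * wmsIter Nv Nc γ β₀ ℓ i j := by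
    simp only [eventually_all]
    intro i j hj
    rw [← hts i j hj]
    exact (htlim i j hj).eventually_ge_atTop _
  obtain ⟨L2, hL2, hL0L2⟩ := (hgrow.and (eventually_gt_atTop L0)).exists
  obtain ⟨T, rfl⟩ := Nat.exists_eq_add_of_lt hL0L2
  have hcont : ∀ ℓ i j, Tendsto (fun δ : ℝ => s i * wmsIter Nv Nc γ (δ / ((dv : ℝ) - 1)) ℓ i j)
      (nhdsWithin 1 (Set.Iio 1)) (nhds (s i * wmsIter Nv Nc γ β₀ ℓ i j)) := by
    intro ℓ i j
    exact ((continuousAt_const.mul (continuousAt_wmsIter Nv Nc γ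
      (continuousAt_id.div_const ((dv : ℝ) - 1)) ℓ i j)).tendsto).mono_left nhdsWithin_le_nhds
  have hev₁ : ∀ᶠ δ : ℝ in nhdsWithin 1 (Set.Iio 1), ∀ n : Fin (T + 1), ∀ i j, j ∈ Nv i →
      M + 1 < s i * wmsIter Nv Nc γ (δ / ((dv : ℝ) - 1)) (L0 + n) i j := by
    simp only [eventually_all]
    exact fun n i j hj => (hcont _ i j).eventually_const_lt
      (by linarith [hlow (L0 + n) (by omega) i j hj])
  have hev₂ : ∀ᶠ δ : ℝ in nhdsWithin 1 (Set.Iio 1), ∀ i j, j ∈ Nv i →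
      s i * wmsIter Nv Nc γ (δ / ((dv : ℝ) - 1)) L0 i j <
        s i * wmsIter Nv Nc γ (δ / ((dv : ℝ) - 1)) (L0 + T + 1) i j := by
    simp only [eventually_all]
    exact fun i j hj => (hcont _ i j).eventually_lt (hcont _ i j) (by linarith [hL2 i j hj])
  have hev₃ : ∀ᶠ δ : ℝ in nhdsWithin 1 (Set.Iio 1), M / (M + 1) < δ :=
    nhdsWithin_le_nhds (eventually_gt_nhds ((div_lt_one (by linarith)).mpr (by linarith)))
  obtain ⟨δ, ⟨⟨hδ₁, hδ₂⟩, hδ₃⟩, hδlt⟩ :=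
    (((hev₁.and hev₂).and hev₃).and self_mem_nhdsWithin).exists
  have hδpos : 0 < δ := lt_of_le_of_lt (by positivity) hδ₃
  refine ⟨L0, lt_of_lt_of_le hLpos (le_max_left _ _), δ, hδpos, hδlt, fun ℓ hℓ i j hj => ?_⟩
  have hbound := le_sign_mul_wmsIter Nv Nc γ (div_pos hδpos hdvpos).le hsym hs hprod
    (c := M + 1) (by linarith) (Nat.succ_pos T)
    (fun n hn i j hj => (hδ₁ ⟨n, hn⟩ i j hj).le) (fun i j hj => (hδ₂ i j hj).le) hℓ i j hj
  have hpos : 0 < s i * wmsIter Nv Nc γ (δ / ((dv : ℝ) - 1)) ℓ i j := by linarith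
  constructor
  · rw [abs_eq_of_mul_pos (hs i) hpos]
    refine le_trans ?_ hbound
    rw [div_le_iff₀ hδpos]
    rw [div_lt_iff₀ (by linarith)] at hδ₃
    linarith
  · rw [hsign_t i j hj, hts i j hj, Real.sign_eq_of_mul_pos (hs i) hpos]
end
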